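/- arXiv:2107.13086 — 2 statements merged into one kernel-verified Lean document; each statement's English description precedes it below -/
import Mathlib

section
/- Let p_k denote the k-th prime number and P(m) = Σ_{k=1}^m (p_k − 1). For each N ∈ ℕ let m = m(N) be the unique natural number with P(m) ≤ N < P(m+1). Then N = (1/2 + o(1)) · m² ln(m) as N → ∞. -/
open Filter Finset
open scoped BigOperators Classical

/-- `starCount ξ N r` = number of indices `n` with `1 ≤ n ≤ N` and `ξ n ∈ [0, r]`
(counted with multiplicity). -/
noncomputable def starCount (ξ : ℕ → ℝ) (N : ℕ) (r : ℝ) : ℕ :=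
  ((Finset.Icc 1 N).filter (fun n => ξ n ∈ Set.Icc (0 : ℝ) r)).card

/-- Star discrepancy of the first `N` terms of the sequence `ξ` (indexed from 1):
`D_N*(ξ) = sup_{0 < r ≤ 1} |A_N(ξ, r)/N − r|`. -/
noncomputable def starDisc (ξ : ℕ → ℝ) (N : ℕ) : ℝ :=
  sSup {d : ℝ | ∃ r : ℝ, 0 < r ∧ r ≤ 1 ∧ d = |(starCount ξ N r : ℝ) / (N : ℝ) - r|}

/-- The `m`-th prime number, 1-indexed: `nthPrime 1 = 2`, `nthPrime 2 = 3`, … -/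
noncomputable def nthPrime (m : ℕ) : ℕ := Nat.nth Nat.Prime (m - 1)

/-- `Psum m = ∑_{k=1}^m (p_k − 1)`, the number of terms in the first `m` blocks of `η`. -/
noncomputable def Psum (m : ℕ) : ℕ := ∑ k ∈ Finset.Icc 1 m, (nthPrime k - 1)

/-- `invMod j p` = the representative in `{0, …, p−1}` of `j⁻¹ (mod p)`. -/
noncomputable def invMod (j p : ℕ) : ℕ := ((j : ZMod p)⁻¹).val

/-- The sequence `η` (indexed from 1), obtained by concatenating over the primes
`p = 2, 3, 5, …` the blocks `(j⁻¹ mod p)/p` for `j = 1, …, p−1`.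
For `n ≥ 1`, if `m` is minimal with `n ≤ Psum (m+1)` (so `Psum m < n ≤ Psum (m+1)`),
then `η n` is the `(n − Psum m)`-th element of the block for the prime `nthPrime (m+1)`. -/
noncomputable def eta (n : ℕ) : ℝ :=
  if h : ∃ m, n ≤ Psum (m + 1) then
    (invMod (n - Psum (Nat.find h)) (nthPrime (Nat.find h + 1)) : ℝ) /
      (nthPrime (Nat.find h + 1) : ℝ)
  else 0

section PNT
open MeasureTheory Topology

lemma pnt_fubini (h : ℝ → ℝ) (hmeas : Measurable h) (C : ℝ) (hC : ∀ u, |h u| ≤ C)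
    (G : ℂ → ℂ)
    (hG : ∀ z : ℂ, 0 < z.re → ∫ u in Set.Ioi (0:ℝ), (h u : ℂ) * Complex.exp (-z * u) = G z)
    (φ : ℝ → ℂ) (hφ : Continuous φ) (hφs : HasCompactSupport φ) (K : ℝ → ℂ)
    (hK : ∀ x : ℝ, K x = ∫ t : ℝ, φ t * Complex.exp (Complex.I * t * x))
    (v ε : ℝ) (hε : 0 < ε) :
    ∫ u in Set.Ioi (0:ℝ), (h u : ℂ) * Complex.exp (-ε * u) * K (v - u) =
      ∫ t : ℝ, φ t * Complex.exp (Complex.I * t * v) * G (ε + t * Complex.I) := by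
  have hφi : Integrable φ := hφ.integrable_of_hasCompactSupport hφs
  have h1 : Integrable (fun u : ℝ => (h u : ℂ) * Complex.exp (-ε * u))
      (volume.restrict (Set.Ioi 0)) := by
    have h0 : Integrable (fun u : ℝ => Real.exp (-ε * u)) (volume.restrict (Set.Ioi 0)) :=
      exp_neg_integrableOn_Ioi 0 hε
    refine (h0.const_mul C).mono' (by fun_prop) (Filter.Eventually.of_forall fun u => ?_)
    rw [norm_mul, Complex.norm_exp, Complex.norm_real, Real.norm_eq_abs]
    simp only [Complex.mul_re, Complex.neg_re, Complex.ofReal_re, Complex.ofReal_im, Complex.neg_im]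
    simp only [neg_zero, sub_zero, mul_zero]
    exact mul_le_mul_of_nonneg_right (hC u) (Real.exp_pos _).le
  have hprod := h1.mul_prod hφi
  have hint : Integrable (Function.uncurry fun (u t : ℝ) =>
      ((h u : ℂ) * Complex.exp (-ε * u) * φ t) * Complex.exp (Complex.I * t * ((v - u : ℝ) : ℂ)))
      ((volume.restrict (Set.Ioi 0)).prod volume) := by
    refine hprod.mono (by
      refine AEStronglyMeasurable.mul hprod.1 ?_
      apply Continuous.aestronglyMeasurable
      fun_prop) (Filter.Eventually.of_forall fun p => ?_)
    rcases p with ⟨u, t⟩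
    simp only [Function.uncurry]
    rw [norm_mul _ (Complex.exp (Complex.I * t * ((v - u : ℝ) : ℂ))), Complex.norm_exp]
    simp
  calc _ = ∫ u in Set.Ioi (0:ℝ), ∫ t : ℝ, 
      ((h u : ℂ) * Complex.exp (-ε * u) * φ t) * Complex.exp (Complex.I * t * ((v - u : ℝ) : ℂ)) := by
        congr 1; ext u
        rw [hK, ← integral_const_mul]
        congr 1; ext t; push_cast; ring
    _ = ∫ t : ℝ, ∫ u in Set.Ioi (0:ℝ), 
      ((h u : ℂ) * Complex.exp (-ε * u) * φ t) * Complex.exp (Complex.I * t * ((v - u : ℝ) : ℂ)) :=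
        integral_integral_swap hint
    _ = _ := by
        congr 1; ext t
        rw [← hG _ (by simpa using hε), ← integral_const_mul]
        congr 1; ext u
        have : Complex.exp (-ε * u) * Complex.exp (Complex.I * t * ((v - u : ℝ) : ℂ)) =
          Complex.exp (Complex.I * t * v) * Complex.exp (-(ε + t * Complex.I) * u) := by
          rw [← Complex.exp_add, ← Complex.exp_add]; congr 1; push_cast; ring
        linear_combination (h u * φ t) * this

lemma pnt_kernel (h : ℝ → ℝ) (hmeas : Measurable h) (C : ℝ) (hC : ∀ u, |h u| ≤ C)
    (G : ℂ → ℂ) (hGc : ContinuousOn G {z | 0 ≤ z.re})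
    (hG : ∀ z : ℂ, 0 < z.re → ∫ u in Set.Ioi (0:ℝ), (h u : ℂ) * Complex.exp (-z * u) = G z)
    (φ : ℝ → ℂ) (hφ : Continuous φ) (hφs : HasCompactSupport φ) (K : ℝ → ℂ)
    (hK : ∀ x : ℝ, K x = ∫ t : ℝ, φ t * Complex.exp (Complex.I * t * x))
    (hKi : Integrable K) :
    Tendsto (fun v : ℝ => ∫ u in Set.Ioi (0:ℝ), (h u : ℂ) * K (v - u)) atTop (𝓝 0) := by
  have hGm : ∀ ε : ℝ, 0 ≤ ε → Continuous (fun t : ℝ => G (ε + t * Complex.I)) := by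
    intro ε hε
    refine hGc.comp_continuous (by fun_prop) (fun t => by simpa using hε)
  obtain ⟨R, hR, hR0⟩ : ∃ R : ℝ, 0 < R ∧ ∀ x : ℝ, R ≤ ‖x‖ → φ x = 0 := hφs.exists_pos_le_norm
  obtain ⟨M, hM⟩ : ∃ M : ℝ, ∀ ε : ℝ, 0 ≤ ε → ε ≤ 1 → ∀ t : ℝ, |t| ≤ R →
      ‖G (ε + t * Complex.I)‖ ≤ M := by
    have hc : IsCompact (Set.Icc (0:ℝ) 1 ×ˢ Set.Icc (-R) R) := isCompact_Icc.prod isCompact_Icc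
    have : ContinuousOn (fun p : ℝ × ℝ => G (p.1 + p.2 * Complex.I))
        (Set.Icc (0:ℝ) 1 ×ˢ Set.Icc (-R) R) := by
      refine hGc.comp (by fun_prop) ?_
      rintro ⟨a, b⟩ hab
      simpa using hab.1.1
    obtain ⟨M, hM⟩ := hc.exists_bound_of_continuousOn this
    exact ⟨M, fun ε h0 h1 t ht => hM (ε, t) ⟨⟨h0, h1⟩, abs_le.mp ht⟩⟩
  have hφi : Integrable φ := hφ.integrable_of_hasCompactSupport hφs
  have key : ∀ v : ℝ, ∫ u in Set.Ioi (0:ℝ), (h u : ℂ) * K (v - u) =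
      ∫ t : ℝ, φ t * Complex.exp (Complex.I * t * v) * G (t * Complex.I) := by
    intro v
    have hKv : Integrable (fun u => K (v - u)) := hKi.comp_sub_left v
    have L1 : Tendsto (fun ε : ℝ => ∫ u in Set.Ioi (0:ℝ), (h u : ℂ) * Complex.exp (-ε * u) * K (v - u))
        (𝓝[>] 0) (𝓝 (∫ u in Set.Ioi (0:ℝ), (h u : ℂ) * K (v - u))) := by
      refine tendsto_integral_filter_of_dominated_convergence (fun u => C * ‖K (v - u)‖) ?_ ?_ ?_ ?_
      · refine Filter.Eventually.of_forall fun ε => ?_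
        refine AEStronglyMeasurable.mul ?_ hKv.1.restrict
        exact Measurable.aestronglyMeasurable (by fun_prop)
      · filter_upwards [self_mem_nhdsWithin] with ε hε
        filter_upwards [ae_restrict_mem measurableSet_Ioi] with u hu
        rw [norm_mul, norm_mul, Complex.norm_exp, Complex.norm_real, Real.norm_eq_abs]
        refine mul_le_mul_of_nonneg_right ?_ (norm_nonneg _)
        have : Real.exp ((-(ε:ℂ) * (u:ℂ)).re) ≤ 1 := by
          rw [Real.exp_le_one_iff]
          have := mul_pos (Set.mem_Ioi.1 hε) (Set.mem_Ioi.1 hu)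
          simp; linarith
        calc _ ≤ |h u| * 1 := by gcongr
          _ ≤ C := by simpa using hC u
      · exact (hKv.norm.const_mul C).restrict
      · refine Filter.Eventually.of_forall fun u => ?_
        have : Continuous (fun ε : ℝ => (h u : ℂ) * Complex.exp (-ε * u) * K (v - u)) := by fun_prop
        have := (this.tendsto 0).mono_left (nhdsWithin_le_nhds (s := Set.Ioi 0))
        simpa using this
    have L2 : Tendsto (fun ε : ℝ => ∫ t : ℝ, φ t * Complex.exp (Complex.I * t * v) * G (ε + t * Complex.I))
        (𝓝[>] 0) (𝓝 (∫ t : ℝ, φ t * Complex.exp (Complex.I * t * v) * G (t * Complex.I))) := by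
      refine tendsto_integral_filter_of_dominated_convergence (fun t => ‖φ t‖ * M) ?_ ?_ ?_ ?_
      · filter_upwards [self_mem_nhdsWithin] with ε hε
        have := hGm ε (le_of_lt hε)
        exact ((hφ.mul (by fun_prop)).mul this).aestronglyMeasurable
      · filter_upwards [self_mem_nhdsWithin, Ioo_mem_nhdsGT (show (0:ℝ) < 1 by norm_num)] with ε hε hε1
        refine Filter.Eventually.of_forall fun t => ?_
        rw [norm_mul, norm_mul, Complex.norm_exp]
        by_cases ht : R ≤ ‖t‖
        · simp [hR0 t ht]
        · have := hM ε (le_of_lt hε) hε1.2.le t (by simpa using (not_le.1 ht).le)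
          simp
          gcongr
      · exact hφi.norm.mul_const M
      · refine Filter.Eventually.of_forall fun t => ?_
        refine Tendsto.const_mul _ ?_
        have h1 : ContinuousWithinAt G {z | 0 ≤ z.re} (t * Complex.I) := hGc _ (by simp)
        refine h1.tendsto.comp (tendsto_nhdsWithin_iff.2 ⟨?_, ?_⟩)
        · have : Continuous (fun ε : ℝ => (ε + t * Complex.I : ℂ)) := by fun_prop
          have := (this.tendsto 0).mono_left (nhdsWithin_le_nhds (s := Set.Ioi 0))
          simpa using this
        · filter_upwards [self_mem_nhdsWithin] with ε hε
          simpa using le_of_lt hε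
    refine tendsto_nhds_unique (L1.congr' ?_) L2
    filter_upwards [self_mem_nhdsWithin] with ε hε
    exact pnt_fubini h hmeas C hC G hG φ hφ hφs K hK v ε hε
  simp_rw [key]
  have RL := Real.tendsto_integral_exp_smul_cocompact (fun t : ℝ => φ t * G (t * Complex.I))
  have hw : Tendsto (fun v : ℝ => -v / (2 * Real.pi)) atTop (cocompact ℝ) := by
    refine Tendsto.mono_right ?_ atBot_le_cocompact
    exact tendsto_neg_atTop_atBot.atBot_div_const (by positivity)
  refine (RL.comp hw).congr fun v => ?_
  simp only [Function.comp]
  congr 1; ext t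
  rw [Circle.smul_def, Real.fourierChar_apply, smul_eq_mul]
  have : (((2 * Real.pi * -(t * (-v / (2 * Real.pi))) : ℝ) : ℂ)) * Complex.I = Complex.I * t * v := by
    have : (2 * Real.pi * -(t * (-v / (2 * Real.pi))) : ℝ) = t * v := by
      field_simp
    rw [this]; push_cast; ring
  rw [this]; ring
end PNT

section PNT
open MeasureTheory Topology

noncomputable def pntK (x : ℝ) : ℝ := Real.sinc (x / 2) ^ 2
noncomputable def pntPhi (t : ℝ) : ℂ := ((max 0 (1 - |t|) : ℝ) : ℂ)

lemma pntPhi_cont : Continuous pntPhi := by unfold pntPhi; fun_prop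
lemma pntPhi_supp : HasCompactSupport pntPhi := by
  refine HasCompactSupport.intro (isCompact_Icc (a := (-1:ℝ)) (b := 1)) fun x hx => ?_
  have : 1 < |x| := by
    by_contra h
    exact hx (abs_le.mp (not_lt.mp h))
  simp [pntPhi, this.le]
lemma pntK_cont : Continuous pntK := by
  unfold pntK
  have := Real.continuous_sinc
  fun_prop
lemma pntK_nonneg (x : ℝ) : 0 ≤ pntK x := sq_nonneg _
lemma pntK_eq (x : ℝ) (hx : x ≠ 0) : pntK x = 2 * (1 - Real.cos x) / x ^ 2 := by
  unfold pntK
  rw [Real.sinc_of_ne_zero (by simpa using hx)]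
  have : Real.cos x = 1 - 2 * Real.sin (x / 2) ^ 2 := by
    rw [show x = 2 * (x / 2) by ring, Real.cos_two_mul, Real.sin_sq]; ring_nf
  rw [this]; field_simp; ring
lemma pntK_int : Integrable pntK := by
  refine (integrable_inv_one_add_sq.const_mul 5).mono' pntK_cont.aestronglyMeasurable
    (Filter.Eventually.of_forall fun x => ?_)
  rw [Real.norm_eq_abs, abs_of_nonneg (pntK_nonneg x), ← div_eq_mul_inv, le_div_iff₀ (by positivity)]
  have h1 : pntK x ≤ 1 := by
    unfold pntK
    rw [sq_le_one_iff_abs_le_one]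
    exact Real.abs_sinc_le_one _
  have h2 : pntK x * x ^ 2 ≤ 4 := by
    rcases eq_or_ne x 0 with rfl | hx
    · norm_num
    · rw [pntK_eq x hx]
      field_simp
      linarith [Real.neg_one_le_cos x]
  linarith
lemma pntK_pos : 0 < ∫ x, pntK x := by
  have := (Continuous.integral_pos_of_hasCompactSupport_nonneg_nonzero (μ := volume)
    (f := fun x => pntK x * max 0 (1 - |x|)) (x := 0) (pntK_cont.mul (by fun_prop)) ?_ ?_ ?_)
  · refine this.trans_le (integral_mono_of_nonneg (Filter.Eventually.of_forall fun x => ?_) pntK_int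
      (Filter.Eventually.of_forall fun x => ?_))
    · exact mul_nonneg (pntK_nonneg x) (le_max_left _ _)
    · refine mul_le_of_le_one_right (pntK_nonneg x) (max_le zero_le_one ?_)
      linarith [abs_nonneg x]
  · have h : HasCompactSupport (fun x : ℝ => max 0 (1 - |x|)) := by
      refine HasCompactSupport.intro (isCompact_Icc (a := (-1:ℝ)) (b := 1)) fun x hx => ?_
      have : 1 < |x| := by
        by_contra h
        exact hx (abs_le.mp (not_lt.mp h))
      simp [this.le]
    exact h.mul_left
  · intro x; exact mul_nonneg (pntK_nonneg x) (le_max_left _ _)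
  · simp [pntK]

lemma pntK_cos (x : ℝ) : ∫ t in (0:ℝ)..1, (1 - t) * Real.cos (t * x) = pntK x / 2 := by
  rcases eq_or_ne x 0 with rfl | hx
  · simp [pntK]
    rw [intervalIntegral.integral_sub (by simp) (by simp)]
    norm_num
  · rw [pntK_eq x hx]
    have hd : ∀ t ∈ Set.uIcc (0:ℝ) 1, HasDerivAt
        (fun t => (1 - t) * Real.sin (t * x) / x - Real.cos (t * x) / x ^ 2)
        ((1 - t) * Real.cos (t * x)) t := by
      intro t _
      have h1 : HasDerivAt (fun t : ℝ => t * x) x t := by simpa using (hasDerivAt_id t).mul_const x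
      have h2 := h1.sin
      have h3 := h1.cos
      have h4 : HasDerivAt (fun t : ℝ => 1 - t) (-1) t := by simpa using (hasDerivAt_id t).const_sub 1
      refine (((h4.mul h2).div_const x).sub (h3.div_const (x ^ 2))).congr_deriv ?_
      field_simp
      ring
    rw [intervalIntegral.integral_eq_sub_of_hasDerivAt hd
      (Continuous.intervalIntegrable (by fun_prop) _ _)]
    simp
    field_simp
    ring

lemma pntK_fourier (x : ℝ) : ((pntK x : ℝ) : ℂ) =
    ∫ t : ℝ, pntPhi t * Complex.exp (Complex.I * t * x) := by
  have hi : Integrable (fun t : ℝ => pntPhi t * Complex.exp (Complex.I * t * x)) := by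
    refine Continuous.integrable_of_hasCompactSupport (pntPhi_cont.mul (by fun_prop)) ?_
    exact pntPhi_supp.mul_right
  have e1 : ∀ t : ℝ, pntPhi t * Complex.exp (Complex.I * t * x) + pntPhi (-t) * Complex.exp (Complex.I * (-t : ℝ) * x)
     = ((2 * (max 0 (1 - |t|) * Real.cos (t * x)) : ℝ) : ℂ) := by
    intro t
    simp only [pntPhi, abs_neg]
    push_cast
    have : 2 * Complex.cos (t * x) = Complex.exp (Complex.I * t * x) + Complex.exp (Complex.I * (-t) * x) := by
      rw [Complex.two_cos]; congr 2 <;> ring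
    linear_combination (-(max 0 (1 - |t|) : ℝ) : ℂ) * this
  have hn : ∫ t : ℝ, pntPhi (-t) * Complex.exp (Complex.I * (-t : ℝ) * x) =
    ∫ t : ℝ, pntPhi t * Complex.exp (Complex.I * t * x) :=
    integral_neg_eq_self (fun t : ℝ => pntPhi t * Complex.exp (Complex.I * t * x)) volume
  have h2 : 2 * ∫ t : ℝ, pntPhi t * Complex.exp (Complex.I * t * x) = 
     ((∫ t : ℝ, 2 * (max 0 (1 - |t|) * Real.cos (t * x)) : ℝ) : ℂ) := by
    rw [← integral_complex_ofReal]
    simp_rw [← e1]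
    rw [integral_add hi hi.comp_neg, hn]; ring
  have h3 : ∫ t : ℝ, 2 * (max 0 (1 - |t|) * Real.cos (t * x)) = 2 * pntK x := by
    have : (fun t : ℝ => 2 * (max 0 (1 - |t|) * Real.cos (t * x))) =
        fun t => (fun s : ℝ => 2 * (max 0 (1 - s) * Real.cos (s * x))) |t| := by
      ext t
      rcases abs_choice t with h | h <;> simp [h]
    rw [this, integral_comp_abs (f := fun s : ℝ => 2 * (max 0 (1 - s) * Real.cos (s * x)))]
    rw [← Set.Ioc_union_Ioi_eq_Ioi (zero_le_one (α := ℝ)), setIntegral_union (by simp) measurableSet_Ioi]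
    · rw [← intervalIntegral.integral_of_le zero_le_one]
      have z : ∫ s in Set.Ioi (1:ℝ), 2 * (max 0 (1 - s) * Real.cos (s * x)) = 0 := by
        refine setIntegral_eq_zero_of_forall_eq_zero fun s hs => ?_
        have : 1 - s ≤ 0 := by linarith [Set.mem_Ioi.1 hs]
        simp [this]
      rw [z, intervalIntegral.integral_const_mul]
      have : ∫ s in (0:ℝ)..1, max 0 (1 - s) * Real.cos (s * x) = pntK x / 2 := by
        rw [← pntK_cos]
        refine intervalIntegral.integral_congr fun s hs => ?_
        rw [Set.uIcc_of_le zero_le_one] at hs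
        rw [max_eq_right (by linarith [hs.2])]
      rw [this]; ring
    · exact (Continuous.integrableOn_Icc (by fun_prop)).mono_set Set.Ioc_subset_Icc_self
    · refine (integrableOn_zero (ε' := ℝ)).congr_fun (fun s hs => ?_) measurableSet_Ioi
      have : 1 - s ≤ 0 := by linarith [Set.mem_Ioi.1 hs]
      simp [this]
  rw [h3] at h2
  push_cast at h2
  exact (mul_left_cancel₀ two_ne_zero h2).symm
end PNT

section PNT
open MeasureTheory Topology

noncomputable def pntB (u : ℝ) : ℝ := Chebyshev.psi (Real.exp u) * Real.exp (-u)

lemma pntB_nonneg (u : ℝ) : 0 ≤ pntB u := mul_nonneg (Chebyshev.psi_nonneg _) (Real.exp_pos _).le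
lemma pntB_le (u : ℝ) : pntB u ≤ Real.log 4 + 4 := by
  unfold pntB
  calc _ ≤ (Real.log 4 + 4) * Real.exp u * Real.exp (-u) := by
        gcongr
        exact Chebyshev.psi_le_const_mul_self (Real.exp_pos _).le
    _ = _ := by rw [mul_assoc, ← Real.exp_add]; simp
lemma pntB_meas : Measurable pntB := by
  unfold pntB
  have := Chebyshev.psi_mono.measurable
  fun_prop
lemma pntB_neg (u : ℝ) (hu : u ≤ 0) : pntB u = 0 := by
  unfold pntB
  rw [Chebyshev.psi_eq_zero_of_le_one (Real.exp_le_one_iff.2 hu), zero_mul]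
lemma pntB_mono (u v : ℝ) (h : u ≤ v) : pntB u * Real.exp (-(v - u)) ≤ pntB v := by
  unfold pntB
  rw [mul_assoc, ← Real.exp_add, show -u + -(v - u) = -v by ring]
  gcongr

noncomputable def pntG (z : ℂ) : ℂ :=
  (ArithmeticFunction.vonMangoldt.LFunctionResidueClassAux (q := 1) 1 (1 + z) - 1) / (1 + z)

lemma pntG_cont : ContinuousOn pntG {z | 0 ≤ z.re} := by
  unfold pntG
  have h := ArithmeticFunction.vonMangoldt.continuousOn_LFunctionResidueClassAux (q := 1) 1
  refine ContinuousOn.div ?_ (by fun_prop) ?_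
  · refine ContinuousOn.sub ?_ (by fun_prop)
    refine h.comp (by fun_prop) ?_
    intro z hz
    simpa using hz
  · intro z hz h0
    have := congrArg Complex.re h0
    simp at this hz
    linarith

lemma pntB_laplace1 (z : ℂ) (hz : 0 < z.re) :
    LSeries (fun n => (ArithmeticFunction.vonMangoldt n : ℂ)) (1 + z) =
      (1 + z) * ∫ u in Set.Ioi (0:ℝ), (pntB u : ℂ) * Complex.exp (-z * u) := by
  have hO : (fun n : ℕ ↦ ∑ k ∈ Finset.Icc 1 n, ArithmeticFunction.vonMangoldt k) =O[atTop]
      fun n ↦ (n : ℝ) ^ (1:ℝ) := by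
    refine Asymptotics.IsBigO.of_bound (Real.log 4 + 4) (Filter.Eventually.of_forall fun n => ?_)
    have h := Chebyshev.psi_le_const_mul_self (x := n) (by positivity)
    unfold Chebyshev.psi at h
    rw [Nat.floor_natCast] at h
    rw [Real.rpow_one, Real.norm_eq_abs, abs_of_nonneg (Finset.sum_nonneg fun _ _ =>
      ArithmeticFunction.vonMangoldt_nonneg)]
    have h' : ∑ k ∈ Finset.Icc 1 n, ArithmeticFunction.vonMangoldt k ≤ (Real.log 4 + 4) * n := h
    simpa using h'
  rw [LSeries_eq_mul_integral_of_nonneg (fun n => ArithmeticFunction.vonMangoldt n) zero_le_one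
    (s := 1 + z) (by simpa using hz) hO (fun n => ArithmeticFunction.vonMangoldt_nonneg)]
  congr 1
  have himg : Real.exp '' Set.Ioi 0 = Set.Ioi 1 := by
    ext y
    simp only [Set.mem_image, Set.mem_Ioi]
    constructor
    · rintro ⟨x, hx, rfl⟩; exact Real.one_lt_exp_iff.2 hx
    · intro hy; exact ⟨Real.log y, Real.log_pos hy, Real.exp_log (by linarith)⟩
  rw [← himg, integral_image_eq_integral_abs_deriv_smul measurableSet_Ioi
    (fun x _ => (Real.hasDerivAt_exp x).hasDerivWithinAt) Real.exp_injective.injOn]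
  congr 1; ext u
  rw [abs_of_pos (Real.exp_pos u)]
  have hpsi : (∑ k ∈ Finset.Icc 1 ⌊Real.exp u⌋₊, ((ArithmeticFunction.vonMangoldt k : ℝ) : ℂ)) =
      ((Chebyshev.psi (Real.exp u) : ℝ) : ℂ) := by
    unfold Chebyshev.psi
    push_cast
    rfl
  rw [hpsi, Complex.real_smul, pntB]
  have : ((Real.exp u : ℝ) : ℂ) ^ (-(1 + z + 1)) = Complex.exp (-(1 + z + 1) * u) := by
    rw [Complex.cpow_def_of_ne_zero (by exact_mod_cast (Real.exp_pos u).ne'), ← Complex.ofReal_log (Real.exp_pos u).le, Real.log_exp]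
    congr 1; ring
  rw [this]
  push_cast
  have e : Complex.exp u * Complex.exp (-(1 + z + 1) * u) = Complex.exp (-u) * Complex.exp (-z * u) := by
    rw [← Complex.exp_add, ← Complex.exp_add]; congr 1; ring
  linear_combination ((Chebyshev.psi (Real.exp u) : ℝ) : ℂ) * e

lemma pntB_integrable (z : ℂ) (hz : 0 < z.re) (h : ℝ → ℝ) (hm : Measurable h) (C : ℝ)
    (hC : ∀ u, |h u| ≤ C) :
    IntegrableOn (fun u : ℝ => (h u : ℂ) * Complex.exp (-z * u)) (Set.Ioi 0) := by
  have h0 : Integrable (fun u : ℝ => Real.exp (-z.re * u)) (volume.restrict (Set.Ioi 0)) :=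
    exp_neg_integrableOn_Ioi 0 hz
  refine (h0.const_mul C).mono' (by fun_prop) (Filter.Eventually.of_forall fun u => ?_)
  rw [norm_mul, Complex.norm_exp, Complex.norm_real, Real.norm_eq_abs]
  simp only [Complex.mul_re, Complex.neg_re, Complex.ofReal_re, Complex.ofReal_im, mul_zero, sub_zero]
  exact mul_le_mul_of_nonneg_right (hC u) (Real.exp_pos _).le

lemma pntB_laplace (z : ℂ) (hz : 0 < z.re) :
    ∫ u in Set.Ioi (0:ℝ), ((pntB u - 1 : ℝ) : ℂ) * Complex.exp (-z * u) = pntG z := by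
  have h1 := pntB_laplace1 z hz
  have hB := pntB_integrable z hz pntB pntB_meas (Real.log 4 + 4) (fun u => by
    rw [abs_of_nonneg (pntB_nonneg u)]; exact pntB_le u)
  have hone := pntB_integrable z hz (fun _ => 1) measurable_const 1 (fun u => by simp)
  have hz0 : z ≠ 0 := by rintro rfl; simp at hz
  have hz1 : 1 + z ≠ 0 := by
    intro h; have := congrArg Complex.re h; simp at this; linarith
  have hi : ∫ u in Set.Ioi (0:ℝ), ((1 : ℝ) : ℂ) * Complex.exp (-z * u) = 1 / z := by
    have := integral_exp_mul_complex_Ioi (a := -z) (by simpa using hz) 0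
    simp only [Complex.ofReal_one, one_mul]
    rw [this]; simp
  have hL : LSeries (fun n => (ArithmeticFunction.vonMangoldt n : ℂ)) (1 + z) =
      ArithmeticFunction.vonMangoldt.LFunctionResidueClassAux (q := 1) 1 (1 + z) + 1 / z := by
    have := ArithmeticFunction.vonMangoldt.eqOn_LFunctionResidueClassAux (q := 1) (a := 1) isUnit_one
      (x := 1 + z) (by simpa using hz)
    rw [this]
    have e : (fun n => ((ArithmeticFunction.vonMangoldt.residueClass (1 : ZMod 1) n : ℝ) : ℂ)) =
      (fun n => (ArithmeticFunction.vonMangoldt n : ℂ)) := by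
      ext n
      unfold ArithmeticFunction.vonMangoldt.residueClass
      rw [Set.indicator_of_mem]
      exact Subsingleton.elim _ _
    rw [e]
    simp
  simp_rw [Complex.ofReal_sub, sub_mul]
  rw [integral_sub hB hone, hi]
  unfold pntG
  rw [hL] at h1
  rw [eq_div_iff hz1]
  linear_combination -h1 + (mul_inv_cancel₀ hz0) * (-1)

lemma pnt_smooth (l : ℝ) (hl : 0 < l) :
    Tendsto (fun v : ℝ => ∫ y, pntB (v - y / l) * pntK y) atTop (𝓝 (∫ y, pntK y)) := by
  have hC : ∀ u, |pntB u - 1| ≤ Real.log 4 + 5 := by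
    intro u
    have := pntB_nonneg u
    have := pntB_le u
    have : 0 ≤ Real.log 4 := Real.log_nonneg (by norm_num)
    rw [abs_le]; constructor <;> linarith
  have hm : Measurable (fun u => pntB (u / l) - 1) := by
    have := pntB_meas
    fun_prop
  have main := pnt_kernel (fun u => pntB (u / l) - 1) hm (Real.log 4 + 5) (fun u => hC _)
    (fun z => l * pntG (l * z)) (by
      refine continuousOn_const.mul (pntG_cont.comp (by fun_prop) ?_)
      intro z hz
      simp at hz ⊢
      positivity) (by
      intro z hz
      rw [← pntB_laplace _ (by simpa using mul_pos hl hz)]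
      have := integral_comp_mul_left_Ioi (fun u : ℝ => ((pntB u - 1 : ℝ) : ℂ) * Complex.exp (-(l * z) * u)) 0 (inv_pos.2 hl)
      rw [mul_zero, Complex.real_smul, inv_inv] at this
      rw [← this]
      congr 1; ext u
      rw [div_eq_inv_mul]
      congr 2
      push_cast
      have : (l : ℂ) ≠ 0 := by exact_mod_cast hl.ne'
      field_simp)
    pntPhi pntPhi_cont pntPhi_supp (fun x => (pntK x : ℂ)) pntK_fourier pntK_int.ofReal
  have main2 : Tendsto (fun v : ℝ => ∫ u in Set.Ioi (0:ℝ), (pntB (u / l) - 1) * pntK (v - u)) atTop (𝓝 0) := by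
    have : ∀ v : ℝ, ∫ u in Set.Ioi (0:ℝ), (((pntB (u / l) - 1 : ℝ)) : ℂ) * ((pntK (v - u) : ℝ) : ℂ) =
      ((∫ u in Set.Ioi (0:ℝ), (pntB (u / l) - 1) * pntK (v - u) : ℝ) : ℂ) := by
      intro v
      rw [← integral_complex_ofReal]
      congr 1; ext u; push_cast; ring
    simp_rw [this] at main
    have := (Complex.continuous_re.tendsto 0).comp main
    simpa [Function.comp_def] using this
  have one : Tendsto (fun v : ℝ => ∫ u in Set.Ioi (0:ℝ), pntK (v - u)) atTop (𝓝 (∫ y, pntK y)) := by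
    have e : ∀ v : ℝ, ∫ u in Set.Ioi (0:ℝ), pntK (v - u) = ∫ y in Set.Iio v, pntK y := by
      intro v
      rw [← integral_indicator measurableSet_Ioi, ← integral_indicator measurableSet_Iio,
        ← integral_sub_left_eq_self _ volume v]
      congr 1; ext u
      simp [Set.indicator]
    simp_rw [e]
    have e2 : ∀ v : ℝ, ∫ y in Set.Iio v, pntK y = ∫ y in Set.Iic v, pntK y := fun v =>
      integral_Iic_eq_integral_Iio.symm
    simp_rw [e2]
    have := AECover.integral_tendsto_of_countably_generated (aecover_Iic (μ := (volume : Measure ℝ)) tendsto_id) pntK_int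
    exact this
  have hs := (main2.add one)
  rw [zero_add] at hs
  have hlv : Tendsto (fun v : ℝ => l * v) atTop atTop := tendsto_id.const_mul_atTop hl
  refine (hs.comp hlv).congr fun v => ?_
  simp only [Function.comp]
  have hK : Integrable (fun u => pntK (l * v - u)) := pntK_int.comp_sub_left _
  rw [← integral_add]
  · simp_rw [sub_mul, one_mul, sub_add_cancel]
    rw [setIntegral_eq_integral_of_forall_compl_eq_zero]
    · rw [← integral_sub_left_eq_self _ volume (l * v)]
      congr 1; ext y
      rw [sub_sub_cancel, sub_div, mul_div_cancel_left₀ _ hl.ne']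
    · intro u hu
      rw [pntB_neg, zero_mul]
      exact div_nonpos_of_nonpos_of_nonneg (by simpa using hu) hl.le
  · refine (hK.integrableOn).bdd_mul (c := Real.log 4 + 5) hm.aestronglyMeasurable (Filter.Eventually.of_forall fun u => ?_)
    exact hC _
  · exact hK.integrableOn
end PNT

section PNT
open MeasureTheory Topology

lemma pntB_intK (v l : ℝ) : Integrable (fun y => pntB (v - y / l) * pntK y) := by
  refine pntK_int.bdd_mul (c := Real.log 4 + 4) ((pntB_meas.comp (by fun_prop : Measurable fun y : ℝ => v - y / l)).aestronglyMeasurable) (Filter.Eventually.of_forall fun u => ?_)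
  rw [Real.norm_eq_abs, abs_of_nonneg (pntB_nonneg _)]
  exact pntB_le _

lemma pnt_upper (Y v : ℝ) (hY : 0 < Y) :
    pntB v * Real.exp (-(2 / Y)) * ∫ y in Set.Icc (-Y) Y, pntK y ≤
      ∫ y, pntB ((v + 1 / Y) - y / Y ^ 2) * pntK y := by
  rw [← integral_const_mul]
  calc _ ≤ ∫ y in Set.Icc (-Y) Y, pntB ((v + 1 / Y) - y / Y ^ 2) * pntK y := by
        refine setIntegral_mono_on (pntK_int.const_mul _).integrableOn (pntB_intK _ _).integrableOn
          measurableSet_Icc fun y hy => ?_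
        refine mul_le_mul_of_nonneg_right ?_ (pntK_nonneg y)
        have h1 : y / Y ^ 2 ≤ 1 / Y := by
          rw [div_le_div_iff₀ (by positivity) hY]; nlinarith [hy.2]
        have h2 : -(1 / Y) ≤ y / Y ^ 2 := by
          rw [← neg_div, div_le_div_iff₀ hY (by positivity)]; nlinarith [hy.1]
        refine le_trans ?_ (pntB_mono v _ (by linarith))
        refine mul_le_mul_of_nonneg_left (Real.exp_le_exp.2 ?_) (pntB_nonneg v)
        have : 2 / Y = 1 / Y + 1 / Y := by ring
        linarith
    _ ≤ _ := setIntegral_le_integral (pntB_intK _ _) (Filter.Eventually.of_forall fun y =>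
        mul_nonneg (pntB_nonneg _) (pntK_nonneg y))

lemma pnt_lower (Y v : ℝ) (hY : 0 < Y) :
      ∫ y, pntB ((v - 1 / Y) - y / Y ^ 2) * pntK y ≤
    pntB v * Real.exp (2 / Y) * (∫ y in Set.Icc (-Y) Y, pntK y) + 
      (Real.log 4 + 4) * ((∫ y, pntK y) - ∫ y in Set.Icc (-Y) Y, pntK y) := by
  have hc : (∫ y, pntK y) - ∫ y in Set.Icc (-Y) Y, pntK y = ∫ y in (Set.Icc (-Y) Y)ᶜ, pntK y := by
    rw [← integral_add_compl (measurableSet_Icc (a := -Y) (b := Y)) pntK_int]; ring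
  rw [hc, ← integral_const_mul, ← integral_const_mul,
    ← integral_add_compl (measurableSet_Icc (a := -Y) (b := Y)) (pntB_intK _ _)]
  refine add_le_add ?_ ?_
  · refine setIntegral_mono_on (pntB_intK _ _).integrableOn (pntK_int.const_mul _).integrableOn 
          measurableSet_Icc fun y hy => ?_
    refine mul_le_mul_of_nonneg_right ?_ (pntK_nonneg y)
    have h1 : y / Y ^ 2 ≤ 1 / Y := by
      rw [div_le_div_iff₀ (by positivity) hY]; nlinarith [hy.2]
    have h2 : -(1 / Y) ≤ y / Y ^ 2 := by
      rw [← neg_div, div_le_div_iff₀ hY (by positivity)]; nlinarith [hy.1]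
    have h3 := pntB_mono (v - 1 / Y - y / Y ^ 2) v (by linarith)
    have h4 : Real.exp (-(2 / Y)) ≤ Real.exp (-(v - (v - 1 / Y - y / Y ^ 2))) := by
      refine Real.exp_le_exp.2 ?_
      have : 2 / Y = 1 / Y + 1 / Y := by ring
      linarith
    have h5 := (mul_le_mul_of_nonneg_left h4 (pntB_nonneg (v - 1 / Y - y / Y ^ 2))).trans h3
    rw [Real.exp_neg, ← div_eq_mul_inv, div_le_iff₀ (Real.exp_pos _)] at h5
    exact h5
  · refine setIntegral_mono_on (pntB_intK _ _).integrableOn (pntK_int.const_mul _).integrableOn 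
          measurableSet_Icc.compl fun y hy => ?_
    exact mul_le_mul_of_nonneg_right (pntB_le _) (pntK_nonneg y)

lemma pntB_tendsto : Tendsto pntB atTop (𝓝 1) := by
  set κ := ∫ y, pntK y with hκ
  have κpos : 0 < κ := pntK_pos
  have hκY : Tendsto (fun Y : ℝ => ∫ y in Set.Icc (-Y) Y, pntK y) atTop (𝓝 κ) :=
    AECover.integral_tendsto_of_countably_generated
      (aecover_Icc (μ := (volume : Measure ℝ)) tendsto_neg_atTop_atBot tendsto_id) pntK_int
  have h2Y : Tendsto (fun Y : ℝ => 2 / Y) atTop (𝓝 0) := tendsto_const_nhds.div_atTop tendsto_id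
  have he : Tendsto (fun Y : ℝ => Real.exp (2 / Y)) atTop (𝓝 1) := by
    simpa [Function.comp_def] using (Real.continuous_exp.tendsto 0).comp h2Y
  have hpos : ∀ᶠ Y : ℝ in atTop, 0 < ∫ y in Set.Icc (-Y) Y, pntK y := hκY.eventually (lt_mem_nhds κpos)
  have ha : Tendsto (fun Y : ℝ => κ * Real.exp (2 / Y) / ∫ y in Set.Icc (-Y) Y, pntK y) atTop (𝓝 1) := by
    have := (he.const_mul κ).div hκY κpos.ne'
    simpa [κpos.ne', Pi.div_def] using this
  have hb : Tendsto (fun Y : ℝ => (κ - (Real.log 4 + 4) * (κ - ∫ y in Set.Icc (-Y) Y, pntK y)) / 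
      (Real.exp (2 / Y) * ∫ y in Set.Icc (-Y) Y, pntK y)) atTop (𝓝 1) := by
    have := (((hκY.const_sub κ).const_mul (Real.log 4 + 4)).const_sub κ).div (he.mul hκY) (by simpa using κpos.ne')
    simpa [κpos.ne', Pi.div_def] using this
  refine tendsto_order.2 ⟨fun c hc => ?_, fun c hc => ?_⟩
  · obtain ⟨Y, hY, hYp, hY0⟩ := ((hb.eventually (lt_mem_nhds hc)).and (hpos.and (eventually_gt_atTop 0))).exists
    have hs := pnt_smooth (Y ^ 2) (by positivity)
    have hs2 := hs.comp (tendsto_atTop_add_const_right atTop (-(1 / Y)) tendsto_id)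
    have hs3 := (hs2.sub_const ((Real.log 4 + 4) * (κ - ∫ y in Set.Icc (-Y) Y, pntK y))).div_const
      (Real.exp (2 / Y) * ∫ y in Set.Icc (-Y) Y, pntK y)
    filter_upwards [hs3.eventually (lt_mem_nhds hY)] with v hv
    refine hv.trans_le ?_
    rw [div_le_iff₀ (mul_pos (Real.exp_pos _) hYp)]
    have := pnt_lower Y v hY0
    simp only [Function.comp, id, ← sub_eq_add_neg]
    linarith
  · obtain ⟨Y, hY, hYp, hY0⟩ := ((ha.eventually (gt_mem_nhds hc)).and (hpos.and (eventually_gt_atTop 0))).exists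
    have hs := pnt_smooth (Y ^ 2) (by positivity)
    have hs2 := hs.comp (tendsto_atTop_add_const_right atTop (1 / Y) tendsto_id)
    have hs3 := (hs2.mul_const (Real.exp (2 / Y))).div_const (∫ y in Set.Icc (-Y) Y, pntK y)
    filter_upwards [hs3.eventually (gt_mem_nhds hY)] with v hv
    refine lt_of_le_of_lt ?_ hv
    rw [le_div_iff₀ hYp]
    have := pnt_upper Y v hY0
    simp only [Function.comp, id]
    refine le_trans (le_of_eq ?_) (mul_le_mul_of_nonneg_right this (Real.exp_pos _).le)
    have e : Real.exp (-(2 / Y)) * Real.exp (2 / Y) = 1 := by rw [← Real.exp_add]; simp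
    linear_combination (-(pntB v) * ∫ y in Set.Icc (-Y) Y, pntK y) * e

lemma pnt_psi : Tendsto (fun x : ℝ => Chebyshev.psi x / x) atTop (𝓝 1) := by
  refine (pntB_tendsto.comp Real.tendsto_log_atTop).congr' ?_
  filter_upwards [eventually_gt_atTop 0] with x hx
  simp only [Function.comp, pntB]
  rw [Real.exp_neg, Real.exp_log hx, div_eq_mul_inv]

lemma pnt_theta : Tendsto (fun x : ℝ => Chebyshev.theta x / x) atTop (𝓝 1) := by
  have h : (fun x : ℝ => Real.sqrt x) =o[atTop] (fun x => x) := by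
    refine (Asymptotics.isLittleO_iff_tendsto' ?_).2 ?_
    · filter_upwards [eventually_gt_atTop 0] with x hx h0
      exact absurd h0 hx.ne'
    · simp only [Real.sqrt_div_self']
      exact tendsto_const_nhds.div_atTop Real.tendsto_sqrt_atTop
  have h2 := (Chebyshev.isBigO_psi_sub_theta_sqrt.trans_isLittleO h).tendsto_div_nhds_zero
  have := pnt_psi.sub h2
  rw [sub_zero] at this
  refine this.congr fun x => ?_
  simp only [Pi.sub_apply]; ring

lemma pnt_pi : Tendsto (fun x : ℝ => (Nat.primeCounting ⌊x⌋₊ : ℝ) * Real.log x / x) atTop (𝓝 1) := by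
  have h1 := Chebyshev.integral_theta_div_log_sq_isLittleO.tendsto_div_nhds_zero
  have := pnt_theta.add h1
  rw [add_zero] at this
  refine this.congr' ?_
  filter_upwards [eventually_ge_atTop 2] with x hx
  rw [Chebyshev.primeCounting_eq_theta_div_log_add_integral hx]
  have : 0 < Real.log x := Real.log_pos (by linarith)
  field_simp

lemma pnt_nth1 : Tendsto (fun n : ℕ => ((n + 1 : ℕ) : ℝ) * Real.log (Nat.nth Nat.Prime n) / (Nat.nth Nat.Prime n : ℝ)) atTop (𝓝 1) := by
  have hp : Tendsto (fun n : ℕ => ((Nat.nth Nat.Prime n : ℕ) : ℝ)) atTop atTop :=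
    tendsto_natCast_atTop_atTop.comp (Nat.nth_strictMono Nat.infinite_setOfPred_prime).tendsto_atTop
  refine (pnt_pi.comp hp).congr fun n => ?_
  simp only [Function.comp, Nat.floor_natCast]
  congr 3
  rw [Nat.primeCounting, Nat.primeCounting', Nat.count_succ, Nat.count_nth_of_infinite Nat.infinite_setOfPred_prime,
    if_pos (Nat.prime_nth_prime n)]
end PNT

section PNT
open MeasureTheory Topology

lemma pnt_p_atTop : Tendsto (fun n : ℕ => ((Nat.nth Nat.Prime n : ℕ) : ℝ)) atTop atTop :=
  tendsto_natCast_atTop_atTop.comp (Nat.nth_strictMono Nat.infinite_setOfPred_prime).tendsto_atTop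

lemma pnt_two_le (n : ℕ) : (2 : ℝ) ≤ (Nat.nth Nat.Prime n : ℕ) := by
  exact_mod_cast (Nat.prime_nth_prime n).two_le

lemma pnt_log : Tendsto (fun n : ℕ => Real.log ((n + 1 : ℕ) : ℝ) / Real.log (Nat.nth Nat.Prime n))
    atTop (𝓝 1) := by
  have hL := Real.tendsto_log_atTop.comp pnt_p_atTop
  have h1 : Tendsto (fun n : ℕ => Real.log (((n + 1 : ℕ) : ℝ) * Real.log (Nat.nth Nat.Prime n) / (Nat.nth Nat.Prime n : ℝ)))
      atTop (𝓝 0) := by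
    have := (Real.continuousAt_log one_ne_zero).tendsto.comp pnt_nth1
    rw [Real.log_one] at this
    exact this
  have h2 := h1.div_atTop hL
  have h3 := (Real.isLittleO_log_id_atTop.tendsto_div_nhds_zero).comp hL
  have h4 := (h2.sub h3).add_const 1
  rw [sub_zero, zero_add] at h4
  refine h4.congr fun n => ?_
  have hp := pnt_two_le n
  have hl : 0 < Real.log (Nat.nth Nat.Prime n) := Real.log_pos (by linarith)
  have hn : (0 : ℝ) < ((n + 1 : ℕ) : ℝ) := by positivity
  simp only [Function.comp, id]
  rw [Real.log_div (by positivity) (by positivity), Real.log_mul (by positivity) (by positivity)]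
  field_simp
  ring

lemma pnt_A_atTop : Tendsto (fun n : ℕ => ((n + 1 : ℕ) : ℝ) * Real.log ((n + 1 : ℕ) : ℝ)) atTop atTop := by
  have h : Tendsto (fun n : ℕ => ((n + 1 : ℕ) : ℝ)) atTop atTop :=
    tendsto_natCast_atTop_atTop.comp (tendsto_add_atTop_nat 1)
  exact h.atTop_mul_atTop₀ (Real.tendsto_log_atTop.comp h)

lemma pnt_nth2 : Tendsto (fun n : ℕ => ((Nat.nth Nat.Prime n : ℕ) - 1 : ℝ) /
    (((n + 1 : ℕ) : ℝ) * Real.log ((n + 1 : ℕ) : ℝ))) atTop (𝓝 1) := by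
  have h1 := (pnt_nth1.mul pnt_log).inv₀ (by norm_num)
  have h2 : Tendsto (fun n : ℕ => (1 : ℝ) / (((n + 1 : ℕ) : ℝ) * Real.log ((n + 1 : ℕ) : ℝ))) atTop (𝓝 0) :=
    tendsto_const_nhds.div_atTop pnt_A_atTop
  have h3 := h1.sub h2
  have e : ((1 : ℝ) * 1)⁻¹ - 0 = 1 := by norm_num
  rw [e] at h3
  refine h3.congr' ?_
  filter_upwards [eventually_ge_atTop 1] with n hn
  have hp := pnt_two_le n
  have hl : 0 < Real.log (Nat.nth Nat.Prime n) := Real.log_pos (by linarith)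
  have hn1 : (1 : ℝ) < ((n + 1 : ℕ) : ℝ) := by exact_mod_cast Nat.lt_succ_of_le hn
  have hl2 := Real.log_pos hn1
  field_simp

noncomputable def pntF (n : ℕ) : ℝ := (n : ℝ) ^ 2 * Real.log n / 2

lemma pntF_bd (k : ℕ) (hk : 1 ≤ k) :
    1 - 1 / (2 * ((k + 1 : ℕ) : ℝ)) ≤ (pntF (k + 1) - pntF k) / (((k + 1 : ℕ) : ℝ) * Real.log ((k + 1 : ℕ) : ℝ)) ∧
    (pntF (k + 1) - pntF k) / (((k + 1 : ℕ) : ℝ) * Real.log ((k + 1 : ℕ) : ℝ)) ≤ 1 + 1 / Real.log ((k + 1 : ℕ) : ℝ) := by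
  have hk1 : (1 : ℝ) ≤ k := by exact_mod_cast hk
  have hx : ((k + 1 : ℕ) : ℝ) = (k : ℝ) + 1 := by push_cast; ring
  unfold pntF
  rw [hx]
  have hl : 0 < Real.log ((k : ℝ) + 1) := Real.log_pos (by linarith)
  have h0 : Real.log k ≤ Real.log ((k : ℝ) + 1) := Real.log_le_log (by linarith) (by linarith)
  have h1 : Real.log ((k : ℝ) + 1) - Real.log k ≤ 1 / k := by
    rw [← Real.log_div (by positivity) (by positivity)]
    refine (Real.log_le_sub_one_of_pos (by positivity)).trans (le_of_eq ?_)
    field_simp; ring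
  have h2 : (k : ℝ) * (Real.log ((k : ℝ) + 1) - Real.log k) ≤ 1 := by
    rw [le_div_iff₀ (by linarith)] at h1; linarith
  set L := Real.log ((k : ℝ) + 1)
  set l := Real.log (k : ℝ)
  set x := (k : ℝ)
  constructor
  · rw [le_div_iff₀ (by positivity)]
    have : (1 - 1 / (2 * (x + 1))) * ((x + 1) * L) = (x + 1 / 2) * L := by field_simp; ring
    rw [this]
    nlinarith [mul_nonneg (sq_nonneg x) (sub_nonneg.2 h0)]
  · rw [div_le_iff₀ (by positivity)]
    have : (1 + 1 / L) * ((x + 1) * L) = (x + 1) * L + (x + 1) := by field_simp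
    rw [this]
    nlinarith [mul_le_mul_of_nonneg_left h2 (by linarith : 0 ≤ x)]

lemma pntF_diff : Tendsto (fun k : ℕ => (pntF (k + 1) - pntF k) / (((k + 1 : ℕ) : ℝ) * Real.log ((k + 1 : ℕ) : ℝ)))
    atTop (𝓝 1) := by
  have h : Tendsto (fun n : ℕ => ((n + 1 : ℕ) : ℝ)) atTop atTop :=
    tendsto_natCast_atTop_atTop.comp (tendsto_add_atTop_nat 1)
  have h1 : Tendsto (fun k : ℕ => 1 - 1 / (2 * ((k + 1 : ℕ) : ℝ))) atTop (𝓝 1) := by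
    have : Tendsto (fun k : ℕ => 1 / (2 * ((k + 1 : ℕ) : ℝ))) atTop (𝓝 0) :=
      tendsto_const_nhds.div_atTop (h.const_mul_atTop (by norm_num))
    have := this.const_sub 1
    rwa [sub_zero] at this
  have h2 : Tendsto (fun k : ℕ => 1 + 1 / Real.log ((k + 1 : ℕ) : ℝ)) atTop (𝓝 1) := by
    have : Tendsto (fun k : ℕ => 1 / Real.log ((k + 1 : ℕ) : ℝ)) atTop (𝓝 0) :=
      tendsto_const_nhds.div_atTop (Real.tendsto_log_atTop.comp h)
    have := this.const_add 1
    rwa [add_zero] at this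
  refine tendsto_of_tendsto_of_tendsto_of_le_of_le' h1 h2 ?_ ?_
  · filter_upwards [eventually_ge_atTop 1] with k hk using (pntF_bd k hk).1
  · filter_upwards [eventually_ge_atTop 1] with k hk using (pntF_bd k hk).2

lemma pntF_atTop : Tendsto pntF atTop atTop := by
  have h : Tendsto (fun n : ℕ => (n : ℝ)) atTop atTop := tendsto_natCast_atTop_atTop
  have h1 := ((tendsto_pow_atTop two_ne_zero).comp h).atTop_mul_atTop₀ (Real.tendsto_log_atTop.comp h)
  exact h1.atTop_div_const (by norm_num)

lemma pntF_mono : Monotone pntF := by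
  refine monotone_nat_of_le_succ fun k => ?_
  rcases Nat.eq_zero_or_pos k with rfl | hk
  · simp [pntF]
  · have h := (pntF_bd k hk).1
    have hk1 : (1 : ℝ) ≤ k := by exact_mod_cast hk
    have hx : ((k + 1 : ℕ) : ℝ) = (k : ℝ) + 1 := by push_cast; ring
    have hl : 0 < Real.log ((k + 1 : ℕ) : ℝ) := Real.log_pos (by rw [hx]; linarith)
    rw [le_div_iff₀ (by positivity)] at h
    have h2 : 1 / (2 * ((k + 1 : ℕ) : ℝ)) ≤ 1 := by
      rw [div_le_one (by positivity), hx]; linarith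
    have : 0 ≤ (1 - 1 / (2 * ((k + 1 : ℕ) : ℝ))) * (((k + 1 : ℕ) : ℝ) * Real.log ((k + 1 : ℕ) : ℝ)) :=
      mul_nonneg (by linarith) (by positivity)
    linarith

lemma pnt_sum_d (n : ℕ) : ∑ i ∈ range n, (pntF (i + 1) - pntF i) = pntF n := by
  rw [Finset.sum_range_sub]; simp [pntF]

lemma pnt_Psum_eq (n : ℕ) : (Psum n : ℝ) = ∑ i ∈ range n, ((Nat.nth Nat.Prime i : ℕ) - 1 : ℝ) := by
  induction n with
  | zero => simp [Psum]
  | succ n ih =>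
    rw [Finset.sum_range_succ, ← ih]
    unfold Psum
    rw [Finset.sum_Icc_succ_top (by omega)]
    push_cast
    congr 1
    simp only [nthPrime, Nat.add_sub_cancel]
    rw [Nat.cast_sub (Nat.prime_nth_prime n).one_le]
    simp

lemma pnt_ratio : Tendsto (fun n : ℕ => ((Nat.nth Nat.Prime n : ℕ) - 1 : ℝ) / (pntF (n + 1) - pntF n)) atTop (𝓝 1) := by
  have h := pnt_nth2.div pntF_diff one_ne_zero
  rw [div_one] at h
  refine h.congr' ?_
  filter_upwards [pnt_A_atTop.eventually_gt_atTop 0] with n hn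
  simp only [Pi.div_apply]
  rw [div_div_div_cancel_right₀ hn.ne']

lemma pnt_d_pos : ∀ᶠ n : ℕ in atTop, 0 < pntF (n + 1) - pntF n := by
  filter_upwards [pntF_diff.eventually (lt_mem_nhds one_pos), pnt_A_atTop.eventually_gt_atTop 0] with n h1 h2
  exact (div_pos_iff_of_pos_right h2).1 h1

lemma pnt_Psum : Tendsto (fun n : ℕ => (Psum n : ℝ) / pntF n) atTop (𝓝 1) := by
  have ho : (fun n : ℕ => ((Nat.nth Nat.Prime n : ℕ) - 1 : ℝ) - (pntF (n + 1) - pntF n)) =o[atTop]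
      (fun n : ℕ => pntF (n + 1) - pntF n) := by
    refine (Asymptotics.isLittleO_iff_tendsto' ?_).2 ?_
    · filter_upwards [pnt_d_pos] with n hn h0
      exact absurd h0 hn.ne'
    · have := pnt_ratio.sub_const 1
      rw [sub_self] at this
      refine this.congr' ?_
      filter_upwards [pnt_d_pos] with n hn
      field_simp
  have h := ho.sum_range (fun n => sub_nonneg.2 (pntF_mono n.le_succ))
    (by simpa only [pnt_sum_d] using pntF_atTop)
  simp only [Finset.sum_sub_distrib (f := fun n : ℕ => ((Nat.nth Nat.Prime n : ℕ) - 1 : ℝ)), pnt_sum_d, ← pnt_Psum_eq] at h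
  have h2 := h.tendsto_div_nhds_zero.add_const 1
  rw [zero_add] at h2
  refine h2.congr' ?_
  filter_upwards [pntF_atTop.eventually_gt_atTop 0] with n hn
  field_simp
  ring

lemma pntF_ratio : Tendsto (fun n : ℕ => pntF (n + 1) / pntF n) atTop (𝓝 1) := by
  have h : Tendsto (fun n : ℕ => ((n + 1 : ℕ) : ℝ)) atTop atTop :=
    tendsto_natCast_atTop_atTop.comp (tendsto_add_atTop_nat 1)
  have hA : Tendsto (fun n : ℕ => (((n + 1 : ℕ) : ℝ) * Real.log ((n + 1 : ℕ) : ℝ)) / pntF (n + 1)) atTop (𝓝 0) := by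
    have : Tendsto (fun n : ℕ => 2 / ((n + 1 : ℕ) : ℝ)) atTop (𝓝 0) := tendsto_const_nhds.div_atTop h
    refine this.congr' ?_
    filter_upwards [eventually_ge_atTop 1] with n hn
    have hn1 : (1 : ℝ) < ((n + 1 : ℕ) : ℝ) := by exact_mod_cast Nat.lt_succ_of_le hn
    have hl2 := Real.log_pos hn1
    unfold pntF
    field_simp
  have h1 := ((pntF_diff.mul hA).const_sub 1).inv₀ (by norm_num)
  have e : ((1 : ℝ) - 1 * 0)⁻¹ = 1 := by norm_num
  rw [e] at h1
  refine h1.congr' ?_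
  filter_upwards [pnt_A_atTop.eventually_gt_atTop 0, pntF_atTop.eventually_gt_atTop 0] with n hn hF
  have hF' : 0 < pntF (n + 1) := hF.trans_le (pntF_mono n.le_succ)
  rw [div_mul_div_cancel₀ hn.ne', sub_div, div_self hF'.ne', sub_sub_cancel, inv_div]

lemma pnt_Psum' : Tendsto (fun n : ℕ => (Psum (n + 1) : ℝ) / pntF n) atTop (𝓝 1) := by
  have h := (pnt_Psum.comp (tendsto_add_atTop_nat 1)).mul pntF_ratio
  rw [one_mul] at h
  refine h.congr' ?_
  filter_upwards [pntF_atTop.eventually_gt_atTop 0] with n hF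
  have hF' : 0 < pntF (n + 1) := hF.trans_le (pntF_mono n.le_succ)
  simp only [Function.comp]
  rw [div_mul_div_cancel₀ hF'.ne']

lemma pnt_Psum_mono : Monotone Psum := fun a b hab =>
  Finset.sum_le_sum_of_subset (Finset.Icc_subset_Icc_right hab)

end PNT

/-- If `m(N)` is the unique natural number with
`P(m(N)) ≤ N < P(m(N)+1)`, then `N = (1/2 + o(1)) · m² ln m` as `N → ∞`. -/
theorem N_asymp_m (m : ℕ → ℕ)
    (hm : ∀ N : ℕ, Psum (m N) ≤ N ∧ N < Psum (m N + 1)) :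
    Filter.Tendsto (fun N : ℕ => (N : ℝ) / ((m N : ℝ) ^ 2 * Real.log (m N)))
      Filter.atTop (nhds (1 / 2)) := by
  have hmt : Tendsto m atTop atTop := by
    refine tendsto_atTop.2 fun M => ?_
    filter_upwards [eventually_ge_atTop (Psum M)] with N hN
    by_contra hlt
    have h1 := pnt_Psum_mono (show m N + 1 ≤ M by omega)
    have h2 := (hm N).2
    omega
  have h1 := pnt_Psum.comp hmt
  have h2 := pnt_Psum'.comp hmt
  have h3 : Tendsto (fun N : ℕ => (N : ℝ) / pntF (m N)) atTop (nhds 1) := by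
    have hp := hmt.eventually (pntF_atTop.eventually_gt_atTop 0)
    refine tendsto_of_tendsto_of_tendsto_of_le_of_le' h1 h2 ?_ ?_
    · filter_upwards [hp] with N hN
      exact div_le_div_of_nonneg_right (by exact_mod_cast (hm N).1) hN.le
    · filter_upwards [hp] with N hN
      exact div_le_div_of_nonneg_right (by exact_mod_cast (hm N).2.le) hN.le
  refine (h3.div_const 2).congr fun N => ?_
  unfold pntF
  rw [div_div, div_mul_cancel₀ _ two_ne_zero]
end

section
/- Let η be the infinite sequence of rationals in [0,1] formed by concatenating, over the primes p = 2, 3, 5, 7, ... in increasing order, the blocks (1⁻¹ mod p)/p, (2⁻¹ mod p)/p, ..., ((p−1)⁻¹ mod p)/p. Let p_k denote the k-th prime, P(m) = Σ_{k=1}^m (p_k − 1), and for each N let m(N) be the unique natural number with P(m(N)) ≤ N < P(m(N)+1). Then N · D_N*(η) ≤ m(N) · (1 + o(1)) as N → ∞. -/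
open Filter Finset
open scoped BigOperators Classical

section KL
variable {p : ℕ} [Fact p.Prime]

noncomputable def Klo (p : ℕ) [Fact p.Prime] (a b : ZMod p) : ℂ :=
  ∑ x : (ZMod p)ˣ, ZMod.stdAddChar (a * (x : ZMod p) + b * ((x⁻¹ : (ZMod p)ˣ) : ZMod p))

lemma add_orth (t : ZMod p) :
    ∑ a : ZMod p, (ZMod.stdAddChar (a * t) : ℂ) = if t = 0 then (p : ℂ) else 0 := by
  have := AddChar.sum_mulShift t (ZMod.isPrimitive_stdAddChar p)
  rw [ZMod.card] at this
  rw [this]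
  split_ifs <;> simp

lemma moment2 {ι : Type*} [Fintype ι] (g h : ι → ZMod p) :
    ∑ a : ZMod p, ∑ b : ZMod p, ‖∑ i, (ZMod.stdAddChar (a * g i + b * h i) : ℂ)‖ ^ 2
      = (p : ℝ) ^ 2 * (((Finset.univ : Finset (ι × ι)).filter
          (fun q => g q.1 = g q.2 ∧ h q.1 = h q.2)).card : ℝ) := by
  have key : ∀ a b : ZMod p, ((‖∑ i, (ZMod.stdAddChar (a * g i + b * h i) : ℂ)‖ ^ 2 : ℝ) : ℂ)
      = ∑ q : ι × ι, (ZMod.stdAddChar (a * (g q.1 - g q.2)) : ℂ) *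
          ZMod.stdAddChar (b * (h q.1 - h q.2)) := by
    intro a b
    push_cast
    rw [← Complex.mul_conj', map_sum, Finset.sum_mul_sum, ← Finset.univ_product_univ, Finset.sum_product]
    refine Finset.sum_congr rfl fun i _ => Finset.sum_congr rfl fun j _ => ?_
    rw [← AddChar.map_neg_eq_conj, ← AddChar.map_add_eq_mul, ← AddChar.map_add_eq_mul]
    congr 1
    ring
  have : ((∑ a : ZMod p, ∑ b : ZMod p, ‖∑ i, (ZMod.stdAddChar (a * g i + b * h i) : ℂ)‖ ^ 2 : ℝ) : ℂ)
      = (p : ℂ) ^ 2 * (((Finset.univ : Finset (ι × ι)).filter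
          (fun q => g q.1 = g q.2 ∧ h q.1 = h q.2)).card : ℂ) := by
    rw [Complex.ofReal_sum]
    simp_rw [Complex.ofReal_sum, key]
    have : ∀ q : ι × ι, ∑ a : ZMod p, ∑ b : ZMod p, (ZMod.stdAddChar (a * (g q.1 - g q.2)) : ℂ) *
          ZMod.stdAddChar (b * (h q.1 - h q.2)) = if g q.1 = g q.2 ∧ h q.1 = h q.2 then (p : ℂ) ^ 2 else 0 := by
      intro q
      rw [← Finset.sum_mul_sum, add_orth, add_orth]
      simp only [sub_eq_zero]
      by_cases h1 : g q.1 = g q.2 <;> by_cases h2 : h q.1 = h q.2 <;> simp [h1, h2, sq]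
    calc _ = ∑ a : ZMod p, ∑ q : ι × ι, ∑ b : ZMod p, (ZMod.stdAddChar (a * (g q.1 - g q.2)) : ℂ) *
          ZMod.stdAddChar (b * (h q.1 - h q.2)) :=
            Finset.sum_congr rfl fun a _ => Finset.sum_comm
      _ = ∑ q : ι × ι, ∑ a : ZMod p, ∑ b : ZMod p, (ZMod.stdAddChar (a * (g q.1 - g q.2)) : ℂ) *
          ZMod.stdAddChar (b * (h q.1 - h q.2)) := Finset.sum_comm
      _ = _ := by
        simp_rw [this]
        rw [← Finset.sum_filter, Finset.sum_const, nsmul_eq_mul, mul_comm]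
  exact_mod_cast this

lemma quad_count :
    ((Finset.univ : Finset (((ZMod p)ˣ × (ZMod p)ˣ) × ((ZMod p)ˣ × (ZMod p)ˣ))).filter
      (fun q => (q.1.1 : ZMod p) + q.1.2 = q.2.1 + q.2.2 ∧
        ((q.1.1⁻¹ : (ZMod p)ˣ) : ZMod p) + ((q.1.2⁻¹ : (ZMod p)ˣ) : ZMod p)
          = ((q.2.1⁻¹ : (ZMod p)ˣ) : ZMod p) + ((q.2.2⁻¹ : (ZMod p)ˣ) : ZMod p))).card
      ≤ 3 * (p - 1) ^ 2 := by
  let U := (ZMod p)ˣ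
  let f1 : U × U → (U × U) × (U × U) := fun z => (z, z)
  let f2 : U × U → (U × U) × (U × U) := fun z => (z, (z.2, z.1))
  let f3 : U × U → (U × U) × (U × U) := fun z => ((z.1, -z.1), (z.2, -z.2))
  have hc : (Finset.univ : Finset (U × U)).card = (p - 1) ^ 2 := by
    rw [Finset.card_univ, Fintype.card_prod, ZMod.card_units, sq]
  have hsub : ((Finset.univ : Finset (((ZMod p)ˣ × (ZMod p)ˣ) × ((ZMod p)ˣ × (ZMod p)ˣ))).filter
      (fun q => (q.1.1 : ZMod p) + q.1.2 = q.2.1 + q.2.2 ∧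
        ((q.1.1⁻¹ : (ZMod p)ˣ) : ZMod p) + ((q.1.2⁻¹ : (ZMod p)ˣ) : ZMod p)
          = ((q.2.1⁻¹ : (ZMod p)ˣ) : ZMod p) + ((q.2.2⁻¹ : (ZMod p)ˣ) : ZMod p)))
      ⊆ (Finset.univ.image f1 ∪ Finset.univ.image f2) ∪ Finset.univ.image f3 := by
    rintro ⟨⟨x, y⟩, ⟨z, w⟩⟩ hq
    simp only [Finset.mem_filter, Finset.mem_univ, true_and] at hq
    obtain ⟨h1, h2⟩ := hq
    have hx := x.ne_zero
    have hy := y.ne_zero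
    have hz := z.ne_zero
    have hw := w.ne_zero
    simp only [Units.val_inv_eq_inv_val] at h2
    simp only [Finset.mem_union, Finset.mem_image, Finset.mem_univ, true_and]
    by_cases hs : (x : ZMod p) + y = 0
    · right
      refine ⟨(x, z), ?_⟩
      have e1 : -x = y := by
        apply Units.ext; push_cast; linear_combination -hs
      have e2 : -z = w := by
        apply Units.ext; push_cast; linear_combination h1 - hs
      simp only [f3, e1, e2]
    · left
      have h3 : ((x : ZMod p) + y) * (z * w) = (x + y) * (x * y) := by
        field_simp at h2
        linear_combination h2 - (x * y : ZMod p) * h1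
      have h4 := mul_left_cancel₀ hs h3
      have h5 : ((z : ZMod p) - x) * (z - y) = 0 := by
        linear_combination (-(z : ZMod p)) * h1 - h4
      rcases mul_eq_zero.1 h5 with h | h
      · left
        refine ⟨(x, y), ?_⟩
        have e1 : x = z := by apply Units.ext; linear_combination -h
        have e2 : y = w := by apply Units.ext; linear_combination h1 + h
        simp only [f1]; rw [e1, e2]
      · right
        refine ⟨(x, y), ?_⟩
        have e1 : y = z := by apply Units.ext; linear_combination -h
        have e2 : x = w := by apply Units.ext; linear_combination h1 + h
        simp only [f2]; rw [e1, e2]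
  refine (Finset.card_le_card hsub).trans ?_
  refine (Finset.card_union_le _ _).trans ?_
  have a1 := Finset.card_union_le (Finset.univ.image f1) (Finset.univ.image f2)
  have b1 := Finset.card_image_le (s := Finset.univ) (f := f1)
  have b2 := Finset.card_image_le (s := Finset.univ) (f := f2)
  have b3 := Finset.card_image_le (s := Finset.univ) (f := f3)
  rw [hc] at b1 b2 b3
  omega

lemma klo_sq (a b : ZMod p) : Klo p a b ^ 2 = ∑ i : (ZMod p)ˣ × (ZMod p)ˣ,
    ZMod.stdAddChar (a * ((i.1 : ZMod p) + (i.2 : ZMod p)) +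
      b * (((i.1⁻¹ : (ZMod p)ˣ) : ZMod p) + ((i.2⁻¹ : (ZMod p)ˣ) : ZMod p))) := by
  rw [sq, Klo, Finset.sum_mul_sum, ← Finset.univ_product_univ, Finset.sum_product]
  refine Finset.sum_congr rfl fun i _ => Finset.sum_congr rfl fun j _ => ?_
  rw [← AddChar.map_add_eq_mul]
  congr 1
  ring

lemma klo_shift (a b : ZMod p) (u : (ZMod p)ˣ) :
    Klo p (a * u) (b * ((u⁻¹ : (ZMod p)ˣ) : ZMod p)) = Klo p a b := by
  unfold Klo
  refine Fintype.sum_equiv (Equiv.mulLeft u) _ _ fun x => ?_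
  congr 1
  simp only [Equiv.coe_mulLeft, mul_inv_rev, Units.val_mul]
  ring

lemma klo_pow4 (a b : ZMod p) (hab : a ≠ 0 ∨ b ≠ 0) : ‖Klo p a b‖ ^ 4 ≤ 3 * (p : ℝ) ^ 3 := by
  have hp : 1 < p := (Fact.out : p.Prime).one_lt
  have hp1 : (0 : ℝ) < ((p - 1 : ℕ) : ℝ) := by exact_mod_cast Nat.sub_pos_of_lt hp
  have hM : ∑ z : ZMod p × ZMod p, ‖Klo p z.1 z.2‖ ^ 4 ≤ (p : ℝ) ^ 2 * (3 * ((p - 1 : ℕ) : ℝ) ^ 2) := by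
    have e : ∀ a b : ZMod p, ‖Klo p a b‖ ^ 4 = ‖∑ i : (ZMod p)ˣ × (ZMod p)ˣ,
      (ZMod.stdAddChar (a * ((i.1 : ZMod p) + (i.2 : ZMod p)) +
      b * (((i.1⁻¹ : (ZMod p)ˣ) : ZMod p) + ((i.2⁻¹ : (ZMod p)ˣ) : ZMod p))) : ℂ)‖ ^ 2 := by
      intro a b
      rw [← klo_sq, norm_pow, ← pow_mul]
    rw [← Finset.univ_product_univ, Finset.sum_product]
    simp only [e]
    rw [moment2]
    gcongr
    exact_mod_cast quad_count
  have hO : ((p - 1 : ℕ) : ℝ) * ‖Klo p a b‖ ^ 4 ≤ ∑ z : ZMod p × ZMod p, ‖Klo p z.1 z.2‖ ^ 4 := by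
    let f : (ZMod p)ˣ → ZMod p × ZMod p := fun u => (a * u, b * ((u⁻¹ : (ZMod p)ˣ) : ZMod p))
    have hf : Function.Injective f := by
      intro u v huv
      simp only [f, Prod.mk.injEq] at huv
      rcases hab with h | h
      · exact Units.ext (mul_left_cancel₀ h huv.1)
      · exact inv_injective (Units.ext (mul_left_cancel₀ h huv.2))
    calc _ = ∑ u : (ZMod p)ˣ, ‖Klo p (f u).1 (f u).2‖ ^ 4 := by
          simp only [f, klo_shift]
          rw [Finset.sum_const, Finset.card_univ, ZMod.card_units, nsmul_eq_mul]
      _ = ∑ z ∈ Finset.univ.image f, ‖Klo p z.1 z.2‖ ^ 4 := by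
          rw [Finset.sum_image (fun x _ y _ h => hf h)]
      _ ≤ _ := Finset.sum_le_sum_of_subset_of_nonneg (Finset.subset_univ _) (fun _ _ _ => by positivity)
  have h := hO.trans hM
  have h2 : ‖Klo p a b‖ ^ 4 ≤ 3 * (p : ℝ) ^ 2 * ((p - 1 : ℕ) : ℝ) := by
    by_contra hc
    push Not at hc
    have := mul_lt_mul_of_pos_left hc hp1
    nlinarith
  refine h2.trans ?_
  have : ((p - 1 : ℕ) : ℝ) ≤ p := by exact_mod_cast Nat.sub_le _ _
  nlinarith [sq_nonneg (p : ℝ)]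

lemma klo_le (a b : ZMod p) (hab : a ≠ 0 ∨ b ≠ 0) : ‖Klo p a b‖ ≤ 2 * (p : ℝ) ^ (3 / 4 : ℝ) := by
  have h := klo_pow4 a b hab
  have hp0 : (0 : ℝ) ≤ p := by positivity
  refine le_of_pow_le_pow_left₀ (n := 4) (by norm_num) (by positivity) (h.trans ?_)
  rw [mul_pow, ← Real.rpow_natCast ((p : ℝ) ^ (3 / 4 : ℝ)) 4, ← Real.rpow_mul hp0]
  norm_num
  have : (0 : ℝ) ≤ (p : ℝ) ^ 3 := by positivity
  linarith

end KL

section FO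
variable {p : ℕ} [Fact p.Prime]

noncomputable def cT (p : ℕ) [Fact p.Prime] (T : ℕ) (a : ZMod p) : ℂ :=
  ∑ n ∈ Finset.range T, ZMod.stdAddChar (-(a * (n : ZMod p)))

lemma cT_zero (T : ℕ) : cT p T 0 = T := by
  simp [cT]

lemma ind_eq (T : ℕ) (hT : T ≤ p) (y : ZMod p) :
    ∑ a : ZMod p, cT p T a * ZMod.stdAddChar (a * y) = if y.val < T then (p : ℂ) else 0 := by
  unfold cT
  simp_rw [Finset.sum_mul, ← AddChar.map_add_eq_mul]
  rw [Finset.sum_comm]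
  have : ∀ n : ℕ, ∑ a : ZMod p, (ZMod.stdAddChar (-(a * (n : ZMod p)) + a * y) : ℂ)
      = if y = n then (p : ℂ) else 0 := by
    intro n
    have := add_orth (y - (n : ZMod p))
    simp only [sub_eq_zero] at this
    rw [← this]
    refine Finset.sum_congr rfl fun a _ => ?_
    congr 1
    ring
  simp_rw [this]
  have h2 : ∀ n ∈ Finset.range T, (if y = (n : ZMod p) then (p : ℂ) else 0)
      = if y.val = n then (p : ℂ) else 0 := by
    intro n hn
    have hn' : n < p := (Finset.mem_range.1 hn).trans_le hT
    have : y = (n : ZMod p) ↔ y.val = n := by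
      constructor
      · rintro rfl
        exact ZMod.val_cast_of_lt hn'
      · rintro rfl
        simp
    simp only [this]
  rw [Finset.sum_congr rfl h2, Finset.sum_ite_eq]
  simp

lemma norm_char_sub_one (a : ZMod p) (ha : a ≠ 0) :
    4 * min (a.val : ℝ) (p - a.val) / p ≤ ‖(ZMod.stdAddChar (-a) : ℂ) - 1‖ := by
  have hp : (0 : ℝ) < p := by exact_mod_cast (Fact.out : p.Prime).pos
  have hlt : (a.val : ℝ) < p := by exact_mod_cast ZMod.val_lt a
  have e1 : ‖(ZMod.stdAddChar (-a) : ℂ) - 1‖ = ‖(ZMod.stdAddChar a : ℂ) - 1‖ := by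
    rw [AddChar.map_neg_eq_conj, ← Complex.norm_conj]
    simp
  have e2 : (ZMod.stdAddChar a : ℂ) = Complex.exp (Complex.I * ((2 * Real.pi * a.val / p : ℝ) : ℂ)) := by
    have := ZMod.stdAddChar_coe (N := p) (a.val : ℤ)
    rw [Int.cast_natCast, ZMod.natCast_zmod_val] at this
    rw [this]
    congr 1
    push_cast
    ring
  rw [e1, e2, Complex.norm_exp_I_mul_ofReal_sub_one]
  have e3 : 2 * Real.pi * a.val / p / 2 = Real.pi * (a.val / p) := by ring
  rw [e3, Real.norm_eq_abs]
  refine le_trans ?_ (le_abs_self _)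
  have hx0 : 0 ≤ (a.val : ℝ) / p := by positivity
  have hx1 : (a.val : ℝ) / p < 1 := by rwa [div_lt_one hp]
  have hmin : 4 * min (a.val : ℝ) (p - a.val) / p = 4 * min ((a.val : ℝ) / p) (1 - a.val / p) := by
    rw [mul_div_assoc, ← min_div_div_right hp.le, sub_div, div_self hp.ne']
  rw [hmin]
  generalize (a.val : ℝ) / p = x at *
  have hpi := Real.pi_pos
  rcases le_total x (1 / 2) with h | h
  · have := Real.mul_le_sin (x := Real.pi * x) (by positivity) (by nlinarith)
    have e : 2 / Real.pi * (Real.pi * x) = 2 * x := by field_simp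
    rw [e] at this
    have := min_le_left x (1 - x)
    linarith
  · have := Real.mul_le_sin (x := Real.pi * (1 - x)) (by apply mul_nonneg hpi.le; linarith) (by nlinarith)
    have e : 2 / Real.pi * (Real.pi * (1 - x)) = 2 * (1 - x) := by field_simp
    have e' : Real.sin (Real.pi * (1 - x)) = Real.sin (Real.pi * x) := by
      rw [← Real.sin_pi_sub]; congr 1; ring
    rw [e, e'] at this
    have := min_le_right x (1 - x)
    linarith

lemma cT_le (T : ℕ) (a : ZMod p) (ha : a ≠ 0) :
    ‖cT p T a‖ ≤ (p : ℝ) / 2 * (1 / a.val + 1 / ((p : ℝ) - a.val)) := by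
  have hp : (0 : ℝ) < p := by exact_mod_cast (Fact.out : p.Prime).pos
  have hlt : (a.val : ℝ) < p := by exact_mod_cast ZMod.val_lt a
  have h0 : (0 : ℝ) < a.val := by
    have : a.val ≠ 0 := by simpa [ZMod.val_eq_zero] using ha
    exact_mod_cast Nat.pos_of_ne_zero this
  have h := norm_char_sub_one a ha
  have hm : 0 < min (a.val : ℝ) (p - a.val) := lt_min h0 (by linarith)
  have hpos : 0 < 4 * min (a.val : ℝ) (p - a.val) / p := by positivity
  have hz : (ZMod.stdAddChar (-a) : ℂ) ≠ 1 := by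
    intro hc
    rw [hc, sub_self, norm_zero] at h
    linarith
  have e : cT p T a = ((ZMod.stdAddChar (-a) : ℂ) ^ T - 1) / (ZMod.stdAddChar (-a) - 1) := by
    rw [← geom_sum_eq hz, cT]
    refine Finset.sum_congr rfl fun n _ => ?_
    rw [← AddChar.map_nsmul_eq_pow]
    congr 1
    rw [nsmul_eq_mul]
    ring
  rw [e, norm_div]
  have hnum : ‖(ZMod.stdAddChar (-a) : ℂ) ^ T - 1‖ ≤ 2 := by
    refine (norm_sub_le _ _).trans ?_
    rw [norm_pow, AddChar.norm_apply]
    norm_num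
  calc _ ≤ 2 / (4 * min (a.val : ℝ) (p - a.val) / p) := by gcongr
    _ = (p : ℝ) / 2 * (1 / min (a.val : ℝ) (p - a.val)) := by field_simp; norm_num
    _ ≤ _ := by
      gcongr
      rcases min_choice (a.val : ℝ) (p - a.val) with h | h <;> rw [h]
      · have : 0 ≤ 1 / ((p : ℝ) - a.val) := by apply one_div_nonneg.2; linarith
        linarith
      · have : 0 ≤ 1 / (a.val : ℝ) := by positivity
        linarith

lemma sum_zmod {f : ℕ → ℝ} : ∑ a : ZMod p, f a.val = ∑ n ∈ Finset.range p, f n := by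
  refine Finset.sum_bij' (fun a _ => a.val) (fun n _ => (n : ZMod p)) ?_ ?_ ?_ ?_ ?_
  · intro a _; exact Finset.mem_range.2 (ZMod.val_lt a)
  · intro a _; exact Finset.mem_univ _
  · intro a _; simp
  · intro n hn; exact ZMod.val_cast_of_lt (Finset.mem_range.1 hn)
  · intro a _; rfl

lemma cT_sum (T : ℕ) (hT : T ≤ p) : ∑ a : ZMod p, ‖cT p T a‖ ≤ (p : ℝ) * (2 + Real.log p) := by
  have hp1 : 1 < p := (Fact.out : p.Prime).one_lt
  have hp : (0 : ℝ) < p := by exact_mod_cast (Fact.out : p.Prime).pos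
  have h1 : ∑ a : ZMod p, ‖cT p T a‖ ≤ ∑ a : ZMod p,
      (fun n : ℕ => if n = 0 then (p : ℝ) else (p : ℝ) / 2 * (1 / n + 1 / ((p : ℝ) - n))) a.val := by
    refine Finset.sum_le_sum fun a _ => ?_
    by_cases ha : a = 0
    · subst ha
      simp [cT_zero, hT]
    · have : a.val ≠ 0 := by simpa [ZMod.val_eq_zero] using ha
      simp only [this, if_false]
      exact cT_le T a ha
  refine h1.trans ?_
  refine (sum_zmod (f := fun n : ℕ => if n = 0 then (p : ℝ) else (p : ℝ) / 2 * (1 / n + 1 / ((p : ℝ) - n)))).trans_le ?_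
  obtain ⟨q, rfl⟩ : ∃ q, p = q + 1 := ⟨p - 1, by omega⟩
  rw [Finset.sum_range_succ']
  simp only [if_true, Nat.add_eq_zero_iff, one_ne_zero, and_false, if_false]
  rw [← Finset.mul_sum, Finset.sum_add_distrib]
  have hH : ∑ i ∈ Finset.range q, (1 / ((i + 1 : ℕ) : ℝ)) = ((harmonic q : ℚ) : ℝ) := by
    simp [harmonic]
  have hH2 : ∑ i ∈ Finset.range q, (1 / (((q + 1 : ℕ) : ℝ) - ((i + 1 : ℕ) : ℝ))) = ((harmonic q : ℚ) : ℝ) := by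
    rw [← hH, ← Finset.sum_range_reflect]
    refine Finset.sum_congr rfl fun i hi => ?_
    have hi := Finset.mem_range.1 hi
    congr 1
    rw [← Nat.cast_sub (by omega)]
    congr 1
    omega
  rw [hH, hH2]
  have hb := harmonic_le_one_add_log q
  have hl : Real.log q ≤ Real.log (q + 1 : ℕ) := by
    apply Real.log_le_log
    · exact_mod_cast (by omega : 0 < q)
    · push_cast; linarith
  nlinarith

lemma count_bound (T1 T2 : ℕ) (h1 : T1 ≤ p) (h2 : T2 ≤ p) :
    |(((Finset.univ : Finset (ZMod p)ˣ).filter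
      (fun x : (ZMod p)ˣ => (x : ZMod p).val < T1 ∧ ((x⁻¹ : (ZMod p)ˣ) : ZMod p).val < T2)).card : ℝ)
        - (T1 : ℝ) * T2 * ((p : ℝ) - 1) / (p : ℝ) ^ 2|
      ≤ 2 * (p : ℝ) ^ (3 / 4 : ℝ) * (2 + Real.log p) ^ 2 := by
  have hp1 : 1 < p := (Fact.out : p.Prime).one_lt
  have hp : (0 : ℝ) < p := by exact_mod_cast (Fact.out : p.Prime).pos
  have hpc : (p : ℂ) ≠ 0 := by exact_mod_cast hp.ne'
  set S := ((Finset.univ : Finset (ZMod p)ˣ).filter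
      (fun x : (ZMod p)ˣ => (x : ZMod p).val < T1 ∧ ((x⁻¹ : (ZMod p)ˣ) : ZMod p).val < T2)).card with hS
  have e1 : (p : ℂ) ^ 2 * (S : ℂ) = ∑ z : ZMod p × ZMod p, cT p T1 z.1 * cT p T2 z.2 * Klo p z.1 z.2 := by
    have : ∀ x : (ZMod p)ˣ, (if (x : ZMod p).val < T1 ∧ ((x⁻¹ : (ZMod p)ˣ) : ZMod p).val < T2
        then (p : ℂ) ^ 2 else 0) = ∑ a : ZMod p, ∑ b : ZMod p, cT p T1 a * cT p T2 b *
          ZMod.stdAddChar (a * (x : ZMod p) + b * ((x⁻¹ : (ZMod p)ˣ) : ZMod p)) := by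
      intro x
      have h := congrArg₂ (· * ·) (ind_eq T1 h1 (x : ZMod p)) (ind_eq T2 h2 ((x⁻¹ : (ZMod p)ˣ) : ZMod p))
      simp only [Finset.sum_mul_sum] at h
      trans
      swap
      · trans
        · exact h.symm
        · refine Finset.sum_congr rfl fun i _ => Finset.sum_congr rfl fun j _ => ?_
          rw [AddChar.map_add_eq_mul]
          ring
      · by_cases c1 : (x : ZMod p).val < T1 <;> by_cases c2 : ((x⁻¹ : (ZMod p)ˣ) : ZMod p).val < T2 <;>
          simp only [c1, c2, if_true, if_false, and_true, and_false, mul_zero, zero_mul, sq]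
    rw [hS, mul_comm, ← nsmul_eq_mul, ← Finset.sum_const, Finset.sum_filter]
    simp_rw [this]
    rw [← Finset.univ_product_univ, Finset.sum_product, Finset.sum_comm]
    refine Finset.sum_congr rfl fun a _ => ?_
    rw [Finset.sum_comm]
    refine Finset.sum_congr rfl fun b _ => ?_
    rw [Klo, Finset.mul_sum]
  have hK0 : Klo p (0 : ZMod p) 0 = (p : ℂ) - 1 := by
    simp only [Klo, zero_mul, add_zero, AddChar.map_zero_eq_one, Finset.sum_const, Finset.card_univ,
      ZMod.card_units, nsmul_eq_mul, mul_one]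
    rw [Nat.cast_sub hp1.le, Nat.cast_one]
  rw [← Finset.add_sum_erase _ _ (Finset.mem_univ (0 : ZMod p × ZMod p))] at e1
  simp only [Prod.fst_zero, Prod.snd_zero, hK0, cT_zero] at e1
  have e2 : (((S : ℝ) - (T1 : ℝ) * T2 * ((p : ℝ) - 1) / (p : ℝ) ^ 2 : ℝ) : ℂ) * (p : ℂ) ^ 2 =
      ∑ z ∈ Finset.univ.erase (0 : ZMod p × ZMod p), cT p T1 z.1 * cT p T2 z.2 * Klo p z.1 z.2 := by
    push_cast
    field_simp
    linear_combination e1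
  have e3 : |(S : ℝ) - (T1 : ℝ) * T2 * ((p : ℝ) - 1) / (p : ℝ) ^ 2| * (p : ℝ) ^ 2 ≤
      2 * (p : ℝ) ^ (3 / 4 : ℝ) * ((p * (2 + Real.log p)) * (p * (2 + Real.log p))) := by
    have := congrArg norm e2
    rw [norm_mul, Complex.norm_real, norm_pow, Complex.norm_natCast, Real.norm_eq_abs] at this
    rw [this]
    calc _ ≤ ∑ z ∈ Finset.univ.erase (0 : ZMod p × ZMod p),
            2 * (p : ℝ) ^ (3 / 4 : ℝ) * (‖cT p T1 z.1‖ * ‖cT p T2 z.2‖) := by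
          refine (norm_sum_le _ _).trans (Finset.sum_le_sum fun z hz => ?_)
          rw [norm_mul, norm_mul, mul_comm]
          gcongr
          apply klo_le
          have := Finset.ne_of_mem_erase hz
          by_contra hc
          push Not at hc
          exact this (Prod.ext hc.1 hc.2)
      _ ≤ ∑ z : ZMod p × ZMod p,
            2 * (p : ℝ) ^ (3 / 4 : ℝ) * (‖cT p T1 z.1‖ * ‖cT p T2 z.2‖) :=
          Finset.sum_le_sum_of_subset_of_nonneg (Finset.subset_univ _) (fun _ _ _ => by positivity)
      _ = 2 * (p : ℝ) ^ (3 / 4 : ℝ) * ((∑ a : ZMod p, ‖cT p T1 a‖) * (∑ b : ZMod p, ‖cT p T2 b‖)) := by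
          rw [← Finset.mul_sum, ← Finset.univ_product_univ, Finset.sum_product, Finset.sum_mul_sum]
      _ ≤ _ := by
          have i1 := cT_sum T1 h1
          have i2 := cT_sum T2 h2
          have : 0 ≤ Real.log p := Real.log_natCast_nonneg p
          gcongr
  have hp2 : (0 : ℝ) < (p : ℝ) ^ 2 := by positivity
  refine le_of_mul_le_mul_right (e3.trans (le_of_eq ?_)) hp2
  ring

end FO

section BL

noncomputable def blk (p L : ℕ) (r : ℝ) : ℕ :=
  ((Finset.Icc 1 L).filter (fun j => (invMod j p : ℝ) / (p : ℝ) ∈ Set.Icc (0 : ℝ) r)).card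

noncomputable def Ebd (p : ℕ) : ℝ := 2 * (p : ℝ) ^ (3 / 4 : ℝ) * (2 + Real.log p) ^ 2 + 2

noncomputable def Tr (p : ℕ) (r : ℝ) : ℕ := min (⌊r * p⌋₊ + 1) p

lemma Tr_bd (p : ℕ) (r : ℝ) (h0 : 0 < r) (h1 : r ≤ 1) :
    r * p ≤ Tr p r ∧ (Tr p r : ℝ) ≤ r * p + 1 := by
  have hp : (0 : ℝ) ≤ p := Nat.cast_nonneg p
  have hn : 0 ≤ r * p := by positivity
  unfold Tr
  push_cast
  constructor
  · apply le_min
    · exact (Nat.lt_floor_add_one _).le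
    · nlinarith
  · exact (min_le_left _ _).trans (by linarith [Nat.floor_le hn])

lemma blk_eq (p : ℕ) [Fact p.Prime] (L : ℕ) (hL : L ≤ p - 1) (r : ℝ) (h0 : 0 < r) :
    blk p L r = ((Finset.univ : Finset (ZMod p)ˣ).filter
      (fun x : (ZMod p)ˣ => (x : ZMod p).val < L + 1 ∧
        ((x⁻¹ : (ZMod p)ˣ) : ZMod p).val < Tr p r)).card := by
  have hp1 : 1 < p := (Fact.out : p.Prime).one_lt
  have hp : (0 : ℝ) < p := by exact_mod_cast (Fact.out : p.Prime).pos
  have cond : ∀ y : ZMod p, ((y.val : ℝ) / (p : ℝ) ∈ Set.Icc (0 : ℝ) r) ↔ y.val < Tr p r := by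
    intro y
    have hy := ZMod.val_lt y
    rw [Set.mem_Icc, Tr, lt_min_iff, Nat.lt_add_one_iff, Nat.le_floor_iff (by positivity), div_le_iff₀ hp]
    constructor
    · rintro ⟨-, h⟩; exact ⟨h, hy⟩
    · rintro ⟨h, -⟩; exact ⟨by positivity, h⟩
  symm
  unfold blk
  refine Finset.card_bij (fun x _ => (x : ZMod p).val) ?_ ?_ ?_
  · intro x hx
    simp only [Finset.mem_filter, Finset.mem_univ, true_and] at hx
    have hx0 : (x : ZMod p).val ≠ 0 := by
      rw [Ne, ZMod.val_eq_zero]; exact x.ne_zero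
    rw [Finset.mem_filter, Finset.mem_Icc]
    refine ⟨⟨by omega, by omega⟩, ?_⟩
    rw [invMod, ZMod.natCast_zmod_val, cond, ← Units.val_inv_eq_inv_val]
    exact hx.2
  · intro x _ y _ h
    exact Units.ext (ZMod.val_injective p h)
  · intro j hj
    rw [Finset.mem_filter, Finset.mem_Icc] at hj
    obtain ⟨⟨hj1, hj2⟩, hj3⟩ := hj
    have hv : ((j : ℕ) : ZMod p).val = j := ZMod.val_cast_of_lt (by omega)
    have hne : ((j : ℕ) : ZMod p) ≠ 0 := by
      intro h
      rw [h, ZMod.val_zero] at hv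
      omega
    refine ⟨Units.mk0 _ hne, ?_, ?_⟩
    · simp only [Finset.mem_filter, Finset.mem_univ, true_and]
      rw [invMod, cond] at hj3
      rw [Units.val_inv_eq_inv_val, Units.val_mk0, hv]
      exact ⟨by omega, hj3⟩
    · simp [hv]

lemma blk_full (p : ℕ) [Fact p.Prime] (r : ℝ) (h0 : 0 < r) (h1 : r ≤ 1) :
    |(blk p (p - 1) r : ℝ) - r * ((p - 1 : ℕ) : ℝ)| ≤ 1 := by
  have hp1 : 1 < p := (Fact.out : p.Prime).one_lt
  obtain ⟨b1, b2⟩ := Tr_bd p r h0 h1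
  have hT1 : 1 ≤ Tr p r := by unfold Tr; exact le_min (by omega) (by omega)
  have hTp : Tr p r ≤ p := min_le_right _ _
  have e : blk p (p - 1) r = Tr p r - 1 := by
    rw [blk_eq p _ le_rfl r h0]
    have : Tr p r - 1 = (Finset.Icc 1 (Tr p r - 1)).card := by simp
    rw [this]
    refine Finset.card_bij (fun x _ => ((x⁻¹ : (ZMod p)ˣ) : ZMod p).val) ?_ ?_ ?_
    · intro x hx
      simp only [Finset.mem_filter, Finset.mem_univ, true_and] at hx
      have hx0 : ((x⁻¹ : (ZMod p)ˣ) : ZMod p).val ≠ 0 := by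
        rw [Ne, ZMod.val_eq_zero]; exact (x⁻¹).ne_zero
      rw [Finset.mem_Icc]
      omega
    · intro x _ y _ h
      exact inv_injective (Units.ext (ZMod.val_injective p h))
    · intro j hj
      rw [Finset.mem_Icc] at hj
      have hv : ((j : ℕ) : ZMod p).val = j := ZMod.val_cast_of_lt (by omega)
      have hne : ((j : ℕ) : ZMod p) ≠ 0 := by
        intro h
        rw [h, ZMod.val_zero] at hv
        omega
      refine ⟨(Units.mk0 _ hne)⁻¹, ?_, ?_⟩
      · simp only [Finset.mem_filter, Finset.mem_univ, true_and]
        rw [inv_inv, Units.val_mk0, hv]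
        refine ⟨?_, by omega⟩
        rw [Nat.sub_add_cancel hp1.le]
        exact ZMod.val_lt _
      · simp only [inv_inv, Units.val_mk0, hv]
  rw [e, Nat.cast_sub hT1, Nat.cast_sub hp1.le, abs_le]
  push_cast
  constructor <;> nlinarith

lemma blk_part (p : ℕ) [Fact p.Prime] (L : ℕ) (hL : L ≤ p - 1) (r : ℝ) (h0 : 0 < r) (h1 : r ≤ 1) :
    |(blk p L r : ℝ) - r * L| ≤ Ebd p := by
  have hp1 : 1 < p := (Fact.out : p.Prime).one_lt
  have hp : (0 : ℝ) < p := by exact_mod_cast (Fact.out : p.Prime).pos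
  obtain ⟨b1, b2⟩ := Tr_bd p r h0 h1
  have hTp : Tr p r ≤ p := min_le_right _ _
  have hc := count_bound (p := p) (L + 1) (Tr p r) (by omega) hTp
  rw [← blk_eq p L hL r h0] at hc
  set X : ℝ := ((L + 1 : ℕ) : ℝ) * ((p : ℝ) - 1) / p with hX
  set Y : ℝ := (Tr p r : ℝ) / p with hY
  have hL' : (L : ℝ) + 1 ≤ p := by exact_mod_cast (by omega : L + 1 ≤ p)
  have hL0 : (0 : ℝ) ≤ L := Nat.cast_nonneg L
  have hXY : ((L + 1 : ℕ) : ℝ) * (Tr p r : ℝ) * ((p : ℝ) - 1) / (p : ℝ) ^ 2 = X * Y := by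
    rw [hX, hY]; field_simp
  rw [hXY] at hc
  have x1 : (L : ℝ) ≤ X := by
    rw [hX, le_div_iff₀ hp]; push_cast; nlinarith
  have x2 : X ≤ L + 1 := by
    rw [hX, div_le_iff₀ hp]; push_cast; nlinarith
  have y1 : r ≤ Y := by rw [hY, le_div_iff₀ hp]; exact b1
  have y2 : (Y - r) * p ≤ 1 := by
    rw [hY, sub_mul, div_mul_cancel₀ _ hp.ne']; linarith
  have d1 : 0 ≤ X * Y - r * L := by nlinarith
  have d2 : X * Y - r * L ≤ 2 := by
    have : X * (Y - r) ≤ p * (Y - r) := by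
      apply mul_le_mul_of_nonneg_right (by linarith) (by linarith)
    nlinarith
  unfold Ebd
  rw [abs_le] at hc ⊢
  constructor <;> linarith [hc.1, hc.2]

lemma nthPrime_prime (k : ℕ) : (nthPrime k).Prime := Nat.prime_nth_prime _

lemma Psum_succ (k : ℕ) : Psum (k + 1) = Psum k + (nthPrime (k + 1) - 1) := by
  unfold Psum
  rw [Finset.sum_Icc_succ_top (by omega)]

lemma Psum_strictMono : StrictMono Psum := by
  refine strictMono_nat_of_lt_succ fun k => ?_
  rw [Psum_succ]
  have := (nthPrime_prime (k + 1)).one_lt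
  omega

lemma eta_block (k j : ℕ) (h1 : 1 ≤ j) (h2 : j ≤ nthPrime (k + 1) - 1) :
    eta (Psum k + j) = (invMod j (nthPrime (k + 1)) : ℝ) / (nthPrime (k + 1) : ℝ) := by
  have h : ∃ m, Psum k + j ≤ Psum (m + 1) := ⟨k, by rw [Psum_succ]; omega⟩
  have hf : Nat.find h = k := by
    rw [Nat.find_eq_iff]
    refine ⟨by rw [Psum_succ]; omega, fun n hn => ?_⟩
    have := Psum_strictMono.monotone (show n + 1 ≤ k by omega)
    omega
  unfold eta
  rw [dif_pos h, hf, Nat.add_sub_cancel_left]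

lemma starCount_block (k L : ℕ) (hL : L ≤ nthPrime (k + 1) - 1) (r : ℝ) :
    starCount eta (Psum k + L) r = starCount eta (Psum k) r + blk (nthPrime (k + 1)) L r := by
  induction L with
  | zero => simp [blk]
  | succ L ih =>
    have e1 : starCount eta (Psum k + (L + 1)) r = starCount eta (Psum k + L) r +
        if eta (Psum k + (L + 1)) ∈ Set.Icc 0 r then 1 else 0 := by
      unfold starCount
      rw [← add_assoc, ← Finset.insert_Icc_right_eq_Icc_add_one (by omega), Finset.filter_insert]
      split_ifs
      · rw [Finset.card_insert_of_notMem (by simp)]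
      · simp
    have e2 : blk (nthPrime (k + 1)) (L + 1) r = blk (nthPrime (k + 1)) L r +
        if (invMod (L + 1) (nthPrime (k + 1)) : ℝ) / (nthPrime (k + 1) : ℝ) ∈ Set.Icc 0 r then 1 else 0 := by
      unfold blk
      rw [← Finset.insert_Icc_right_eq_Icc_add_one (by omega), Finset.filter_insert]
      split_ifs
      · rw [Finset.card_insert_of_notMem (by simp)]
      · simp
    rw [e1, e2, ih (by omega), eta_block k (L + 1) (by omega) hL, add_assoc]

lemma starCount_full (k : ℕ) (r : ℝ) (h0 : 0 < r) (h1 : r ≤ 1) :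
    |(starCount eta (Psum k) r : ℝ) - r * (Psum k : ℝ)| ≤ k := by
  induction k with
  | zero => simp [Psum, starCount]
  | succ k ih =>
    haveI : Fact (nthPrime (k + 1)).Prime := ⟨nthPrime_prime _⟩
    have hb := blk_full (nthPrime (k + 1)) r h0 h1
    rw [Psum_succ, starCount_block k _ le_rfl]
    rw [abs_le] at ih hb ⊢
    push_cast
    constructor <;> linarith [ih.1, ih.2, hb.1, hb.2]

lemma starDisc_le (N k : ℕ) (hN : 0 < N) (h1 : Psum k ≤ N) (h2 : N < Psum (k + 1)) :
    (N : ℝ) * starDisc eta N ≤ k + Ebd (nthPrime (k + 1)) := by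
  haveI : Fact (nthPrime (k + 1)).Prime := ⟨nthPrime_prime _⟩
  have hN' : (0 : ℝ) < N := by exact_mod_cast hN
  obtain ⟨L, rfl⟩ := Nat.exists_eq_add_of_le h1
  have hL : L ≤ nthPrime (k + 1) - 1 := by rw [Psum_succ] at h2; omega
  rw [mul_comm, ← le_div_iff₀ hN']
  unfold starDisc
  apply csSup_le
  · exact ⟨_, 1, one_pos, le_rfl, rfl⟩
  · rintro d ⟨r, hr0, hr1, rfl⟩
    rw [le_div_iff₀ hN']
    have e : |(starCount eta (Psum k + L) r : ℝ) / ((Psum k + L : ℕ) : ℝ) - r| * ((Psum k + L : ℕ) : ℝ)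
        = |(starCount eta (Psum k + L) r : ℝ) - r * ((Psum k + L : ℕ) : ℝ)| := by
      conv_lhs => rw [← abs_of_pos hN']
      rw [← abs_mul, sub_mul, abs_of_pos hN', div_mul_cancel₀ _ hN'.ne']
    rw [e, starCount_block k L hL]
    have hb := blk_part (nthPrime (k + 1)) L hL r hr0 hr1
    have hf := starCount_full k r hr0 hr1
    rw [abs_le] at hf hb ⊢
    push_cast
    constructor <;> linarith [hf.1, hf.2, hb.1, hb.2]

end BL

section LI
open Asymptotics

lemma pi_lower : ∀ᶠ n : ℕ in atTop, (n : ℝ) ^ (4 / 5 : ℝ) ≤ (Nat.primeCounting n : ℝ) - 1 := by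
  have a1 : (fun x : ℝ => Real.log x) =o[atTop] fun x : ℝ => x ^ (1 / 5 : ℝ) :=
    isLittleO_log_rpow_atTop (by norm_num)
  have c1 := (a1.def (c := 1 / 10) (by norm_num)).natCast_atTop
  filter_upwards [c1, eventually_ge_atTop 2] with n h hn
  have hn1 : (2 : ℝ) ≤ n := by exact_mod_cast hn
  have hl : 0 < Real.log n := Real.log_pos (by linarith)
  rw [Real.norm_of_nonneg hl.le, Real.norm_of_nonneg (by positivity)] at h
  have hpi := Chebyshev.pi_ge n
  have key : (n : ℝ) ^ (4 / 5 : ℝ) + 1 ≤ ((n : ℝ) * Real.log 2 - Real.log (n + 1)) / Real.log n := by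
    rw [le_div_iff₀ hl]
    have e : (n : ℝ) ^ (4 / 5 : ℝ) * (n : ℝ) ^ (1 / 5 : ℝ) = n := by
      rw [← Real.rpow_add (by linarith)]; norm_num
    have g1 : (1 : ℝ) ≤ (n : ℝ) ^ (4 / 5 : ℝ) := Real.one_le_rpow (by linarith) (by norm_num)
    have g2 : (1 : ℝ) ≤ (n : ℝ) ^ (1 / 5 : ℝ) := Real.one_le_rpow (by linarith) (by norm_num)
    have l2 := Real.log_two_gt_d9
    have hl1 : Real.log ((n : ℝ) + 1) ≤ 2 * Real.log n := by
      rw [two_mul, ← Real.log_mul (by linarith) (by linarith)]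
      apply Real.log_le_log (by linarith); nlinarith
    nlinarith
  linarith

lemma E_little : Tendsto (fun n : ℕ => Ebd n / (n : ℝ) ^ (4 / 5 : ℝ)) atTop (nhds 0) := by
  have a0 : (fun _ : ℝ => (2 : ℝ)) =o[atTop] fun x : ℝ => x ^ (1 / 40 : ℝ) := by
    rw [isLittleO_const_left]
    right
    exact tendsto_norm_atTop_atTop.comp (tendsto_rpow_atTop (by norm_num))
  have a1 : (fun x : ℝ => Real.log x) =o[atTop] fun x : ℝ => x ^ (1 / 40 : ℝ) :=
    isLittleO_log_rpow_atTop (by norm_num)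
  have a2 := (a0.add a1).pow (n := 2) (by norm_num)
  have a3 : (fun x : ℝ => 2 * x ^ (3 / 4 : ℝ)) =O[atTop] fun x : ℝ => x ^ (3 / 4 : ℝ) :=
    (isBigO_refl _ _).const_mul_left 2
  have a4 := a3.mul_isLittleO a2
  have a5 : (fun x : ℝ => x ^ (3 / 4 : ℝ) * (x ^ (1 / 40 : ℝ)) ^ 2) =ᶠ[atTop] fun x : ℝ => x ^ (4 / 5 : ℝ) := by
    filter_upwards [eventually_gt_atTop 0] with x hx
    rw [← Real.rpow_natCast (x ^ (1 / 40 : ℝ)) 2, ← Real.rpow_mul hx.le, ← Real.rpow_add hx]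
    norm_num
  have a6 := a4.trans_eventuallyEq a5
  have a7 : (fun _ : ℝ => (2 : ℝ)) =o[atTop] fun x : ℝ => x ^ (4 / 5 : ℝ) := by
    rw [isLittleO_const_left]
    right
    exact tendsto_norm_atTop_atTop.comp (tendsto_rpow_atTop (by norm_num))
  have a8 := (a6.add a7).tendsto_div_nhds_zero
  exact a8.comp tendsto_natCast_atTop_atTop

lemma E_pi : Tendsto (fun n : ℕ => Ebd n / ((Nat.primeCounting n : ℝ) - 1)) atTop (nhds 0) := by
  refine tendsto_of_tendsto_of_tendsto_of_le_of_le' tendsto_const_nhds E_little ?_ ?_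
  · filter_upwards [pi_lower] with n h
    have : 0 ≤ Ebd n := by unfold Ebd; positivity
    exact div_nonneg this (le_trans (by positivity) h)
  · filter_upwards [pi_lower, eventually_ge_atTop 1] with n h hn
    have : 0 ≤ Ebd n := by unfold Ebd; positivity
    have : (0 : ℝ) < n := by exact_mod_cast hn
    gcongr

lemma G_lim : Tendsto (fun k : ℕ => Ebd (nthPrime (k + 1)) / (k : ℝ)) atTop (nhds 0) := by
  have hn : Tendsto (fun k : ℕ => nthPrime (k + 1)) atTop atTop := by
    refine tendsto_atTop_mono (fun k => ?_) tendsto_id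
    have := Nat.add_two_le_nth_prime k
    simp only [nthPrime, Nat.add_sub_cancel, id]
    omega
  refine (E_pi.comp hn).congr fun k => ?_
  simp only [Function.comp]
  congr 1
  have : Nat.primeCounting (nthPrime (k + 1)) = k + 1 := by
    simp only [nthPrime, Nat.add_sub_cancel, Nat.primeCounting, Nat.primeCounting']
    exact Nat.count_nth_succ_of_infinite Nat.infinite_setOf_prime k
  rw [this]
  push_cast
  ring

end LI

/-- If `m(N)` is the unique natural number with
`P(m(N)) ≤ N < P(m(N)+1)`, then `N · D_N*(η) ≤ m(N) · (1 + o(1))` as `N → ∞`. -/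
theorem eta_ND_le (m : ℕ → ℕ)
    (hm : ∀ N : ℕ, Psum (m N) ≤ N ∧ N < Psum (m N + 1)) :
    ∃ f : ℕ → ℝ, Filter.Tendsto f Filter.atTop (nhds 0) ∧
      ∀ᶠ N : ℕ in Filter.atTop,
        (N : ℝ) * starDisc eta N ≤ (m N : ℝ) * (1 + f N) := by
  have hmt : Tendsto m atTop atTop := by
    rw [tendsto_atTop]
    intro b
    filter_upwards [eventually_ge_atTop (Psum b)] with N hN
    by_contra hc
    push Not at hc
    have := Psum_strictMono.monotone (show m N + 1 ≤ b by omega)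
    have := (hm N).2
    omega
  refine ⟨fun N => Ebd (nthPrime (m N + 1)) / (m N : ℝ), G_lim.comp hmt, ?_⟩
  filter_upwards [eventually_ge_atTop 1, hmt.eventually_ge_atTop 1] with N hN hm1
  have h := starDisc_le N (m N) hN (hm N).1 (hm N).2
  have : (0 : ℝ) < m N := by exact_mod_cast hm1
  rw [mul_add, mul_one, mul_div_cancel₀ _ this.ne']
  exact h
end
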